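/- arXiv:1009.4244 — 5 statements merged into one kernel-verified Lean document; each statement's English description precedes it below -/
import Mathlib

section
/- Let m ≥ 2, let C be an algebraic curvature tensor on ℝ^m, and set K^i_j(x) = 4 Σ_{k,l} C_{ikjl} x_k x_l. Let N^i_{jk}(x) = Σ_ℓ [ K^i_ℓ (∂_k K^ℓ_j − ∂_j K^ℓ_k) + K^ℓ_j ∂_ℓ K^i_k − K^ℓ_k ∂_ℓ K^i_j ] be the Nijenhuis tensor of K. Then the first Tonolo–Schouten–Nijenhuis condition Alt_{[i,j,k]} Σ_ℓ N^ℓ_{ij}(x) δ_{kℓ} = 0 holds for all x ∈ ℝ^m if and only if C satisfies condition (T1): Sym_{(p,q,r)} Alt_{[i,j,k]} Σ_ℓ C_{ℓpqi} C_{jkrℓ} = 0 for all indices p,q,r,i,j,k. -/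
/-- Partial derivative `∂f/∂xᵢ` of a scalar function on `ℝ^m` at `x`. -/
noncomputable def pd {m : ℕ} (f : (Fin m → ℝ) → ℝ) (i : Fin m) (x : Fin m → ℝ) : ℝ :=
  fderiv ℝ f x (Pi.single i 1)

/-- An algebraic curvature tensor on `ℝ^m`. -/
def IsACT {m : ℕ} (C : Fin m → Fin m → Fin m → Fin m → ℝ) : Prop :=
  (∀ i j k l, C i j k l = - C j i k l) ∧
  (∀ i j k l, C i j k l = C k l i j) ∧
  (∀ i j k l, C i j k l + C i k l j + C i l j k = 0)

/-- Signed sum over all permutations of the three indices. -/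
noncomputable def alt3 {α : Type*} (F : α → α → α → ℝ) (i j k : α) : ℝ :=
  F i j k - F i k j - F j i k + F j k i + F k i j - F k j i

/-- Sum over all permutations of the three indices. -/
noncomputable def sym3 {α : Type*} (F : α → α → α → ℝ) (p q r : α) : ℝ :=
  F p q r + F p r q + F q p r + F q r p + F r p q + F r q p

/-- The spherical Killing tensor `K^i_j(x) = 4 Σ_{k,l} C_{ikjl} xₖ xₗ`. -/
noncomputable def Kf {m : ℕ} (C : Fin m → Fin m → Fin m → Fin m → ℝ)
    (x : Fin m → ℝ) (i j : Fin m) : ℝ :=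
  4 * ∑ k, ∑ l, C i k j l * x k * x l

/-- The Nijenhuis tensor `N^i_{jk}` of the (1,1)-tensor `K^i_j(x) = 4 C_{ikjl} xₖ xₗ`. -/
noncomputable def Nij {m : ℕ} (C : Fin m → Fin m → Fin m → Fin m → ℝ)
    (x : Fin m → ℝ) (i j k : Fin m) : ℝ :=
  ∑ l, (Kf C x i l * (pd (fun y => Kf C y l j) k x - pd (fun y => Kf C y l k) j x)
    + Kf C x l j * pd (fun y => Kf C y i k) l x
    - Kf C x l k * pd (fun y => Kf C y i j) l x)

/-- Condition (T1): `Sym_{(p,q,r)} Alt_{[i,j,k]} Σₗ C_{ℓpqi} C_{jkrℓ} = 0`. -/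
def T1 {m : ℕ} (C : Fin m → Fin m → Fin m → Fin m → ℝ) : Prop :=
  ∀ p q r i j k : Fin m,
    sym3 (fun p' q' r' =>
      alt3 (fun i' j' k' => ∑ l, C l p' q' i' * C j' k' r' l) i j k) p q r = 0

lemma sum_mul_single {m : ℕ} (f : Fin m → ℝ) (p : Fin m) :
    ∑ a, f a * (Pi.single p 1 : Fin m → ℝ) a = f p := by
  simp [Pi.single_apply]

/-- The trilinear form on `ℝ^m` with coefficients `T`. -/
def trilin {m : ℕ} (T : Fin m → Fin m → Fin m → ℝ) (x y z : Fin m → ℝ) : ℝ :=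
  ∑ a, ∑ b, ∑ c, T a b c * x a * y b * z c

lemma trilin_add_left {m : ℕ} (T : Fin m → Fin m → Fin m → ℝ) (x x' y z : Fin m → ℝ) :
    trilin T (x + x') y z = trilin T x y z + trilin T x' y z := by
  simp only [trilin, ← Finset.sum_add_distrib, Pi.add_apply]
  exact Finset.sum_congr rfl fun a _ => Finset.sum_congr rfl fun b _ =>
    Finset.sum_congr rfl fun c _ => by ring

lemma trilin_add_mid {m : ℕ} (T : Fin m → Fin m → Fin m → ℝ) (x y y' z : Fin m → ℝ) :
    trilin T x (y + y') z = trilin T x y z + trilin T x y' z := by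
  simp only [trilin, ← Finset.sum_add_distrib, Pi.add_apply]
  exact Finset.sum_congr rfl fun a _ => Finset.sum_congr rfl fun b _ =>
    Finset.sum_congr rfl fun c _ => by ring

lemma trilin_add_right {m : ℕ} (T : Fin m → Fin m → Fin m → ℝ) (x y z z' : Fin m → ℝ) :
    trilin T x y (z + z') = trilin T x y z + trilin T x y z' := by
  simp only [trilin, ← Finset.sum_add_distrib, Pi.add_apply]
  exact Finset.sum_congr rfl fun a _ => Finset.sum_congr rfl fun b _ =>
    Finset.sum_congr rfl fun c _ => by ring

lemma trilin_single {m : ℕ} (T : Fin m → Fin m → Fin m → ℝ) (p q r : Fin m) :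
    trilin T (Pi.single p 1) (Pi.single q 1) (Pi.single r 1) = T p q r := by
  simp only [trilin, sum_mul_single]

lemma trilin_swap_left {m : ℕ} (T : Fin m → Fin m → Fin m → ℝ) (x : Fin m → ℝ) :
    trilin (fun a b c => T b a c) x x x = trilin T x x x := by
  unfold trilin
  rw [Finset.sum_comm]
  exact Finset.sum_congr rfl fun a _ => Finset.sum_congr rfl fun b _ =>
    Finset.sum_congr rfl fun c _ => by ring

lemma trilin_swap_right {m : ℕ} (T : Fin m → Fin m → Fin m → ℝ) (x : Fin m → ℝ) :
    trilin (fun a b c => T a c b) x x x = trilin T x x x := by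
  unfold trilin
  refine Finset.sum_congr rfl fun a _ => ?_
  rw [Finset.sum_comm]
  exact Finset.sum_congr rfl fun b _ => Finset.sum_congr rfl fun c _ => by ring

lemma trilin_sym3 {m : ℕ} (T : Fin m → Fin m → Fin m → ℝ) (x : Fin m → ℝ) :
    trilin (sym3 T) x x x = 6 * trilin T x x x := by
  have h1 := trilin_swap_right T x
  have h2 := trilin_swap_left T x
  have h3 := trilin_swap_right (fun a b c => T b a c) x
  have h4 := trilin_swap_left (fun a b c => T a c b) x
  have h : trilin (sym3 T) x x x = trilin T x x x + trilin (fun a b c => T a c b) x x x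
      + trilin (fun a b c => T b a c) x x x + trilin (fun a b c => T b c a) x x x
      + trilin (fun a b c => T c a b) x x x + trilin (fun a b c => T c b a) x x x := by
    simp only [trilin, ← Finset.sum_add_distrib, sym3]
    exact Finset.sum_congr rfl fun a _ => Finset.sum_congr rfl fun b _ =>
      Finset.sum_congr rfl fun c _ => by ring
  have h5 := trilin_swap_right (fun a b c => T b c a) x
  linarith

/-- A cubic form vanishes identically iff its symmetrized coefficients vanish. -/
lemma trilin_diag_eq_zero_iff {m : ℕ} (T : Fin m → Fin m → Fin m → ℝ) :
    (∀ x, trilin T x x x = 0) ↔ ∀ p q r, sym3 T p q r = 0 := by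
  constructor
  · intro h p q r
    have polar : ∀ x y z, trilin T x y z + trilin T x z y + trilin T y x z + trilin T y z x
        + trilin T z x y + trilin T z y x = 0 := by
      intro x y z
      have h1 := h (x + y + z)
      have h2 := h (x + y)
      have h3 := h (x + z)
      have h4 := h (y + z)
      simp only [trilin_add_left, trilin_add_mid, trilin_add_right] at h1 h2 h3 h4
      linarith [h x, h y, h z]
    simpa only [trilin_single, sym3] using polar (Pi.single p 1) (Pi.single q 1) (Pi.single r 1)
  · intro h x
    have h0 : trilin (sym3 T) x x x = 0 := by simp [trilin, h]
    linarith [trilin_sym3 T x]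

lemma pd_Kf {m : ℕ} (C : Fin m → Fin m → Fin m → Fin m → ℝ) (x : Fin m → ℝ) (i j k : Fin m) :
    pd (fun y => Kf C y i j) k x = 4 * ∑ b, (C i k j b + C i b j k) * x b := by
  have h : HasFDerivAt (fun y : Fin m → ℝ => Kf C y i j)
      ((4 : ℝ) • ∑ a, ∑ b, ((C i a j b * x a) • ContinuousLinearMap.proj (R := ℝ) b
        + x b • C i a j b • ContinuousLinearMap.proj (R := ℝ) (φ := fun _ : Fin m => ℝ) a)) x := by
    unfold Kf
    refine HasFDerivAt.const_mul (HasFDerivAt.fun_sum fun a _ => HasFDerivAt.fun_sum fun b _ => ?_) 4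
    exact ((hasFDerivAt_apply (𝕜 := ℝ) a x).const_mul (C i a j b)).mul (hasFDerivAt_apply b x)
  rw [pd, h.fderiv]
  simp only [smul_apply, sum_apply,
    add_apply, ContinuousLinearMap.proj_apply, smul_eq_mul,
    Finset.sum_add_distrib, sum_mul_single, add_mul]
  rw [Finset.sum_comm (f := fun a b => x b * (C i a j b * _))]
  simp only [← mul_assoc, sum_mul_single]
  rw [add_comm]
  simp only [mul_comm]

lemma Kf_symm {m : ℕ} {C : Fin m → Fin m → Fin m → Fin m → ℝ} (hC : IsACT C)
    (x : Fin m → ℝ) (i j : Fin m) : Kf C x i j = Kf C x j i := by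
  unfold Kf
  rw [Finset.sum_comm]
  congr 1
  refine Finset.sum_congr rfl fun a _ => Finset.sum_congr rfl fun b _ => ?_
  rw [hC.2.1 i b j a]
  ring

lemma IsACT.swap_right {m : ℕ} {C : Fin m → Fin m → Fin m → Fin m → ℝ} (hC : IsACT C)
    (i j k l : Fin m) : C i j k l = - C i j l k := by
  rw [hC.2.1, hC.1, hC.2.1]

lemma Kf_eq_neg {m : ℕ} {C : Fin m → Fin m → Fin m → Fin m → ℝ} (hC : IsACT C)
    (x : Fin m → ℝ) (i l : Fin m) :
    Kf C x i l = -4 * ∑ a, ∑ b, C l a b i * x a * x b := by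
  rw [Kf_symm hC, Kf, neg_mul, ← mul_neg, ← Finset.sum_neg_distrib]
  congr 1
  refine Finset.sum_congr rfl fun a _ => ?_
  rw [← Finset.sum_neg_distrib]
  refine Finset.sum_congr rfl fun b _ => ?_
  rw [hC.swap_right l a i b]
  ring

lemma pd_Kf_sub {m : ℕ} {C : Fin m → Fin m → Fin m → Fin m → ℝ} (hC : IsACT C)
    (x : Fin m → ℝ) (l j k : Fin m) :
    pd (fun y => Kf C y l j) k x - pd (fun y => Kf C y l k) j x
      = -12 * ∑ c, C j k c l * x c := by
  rw [pd_Kf, pd_Kf, ← mul_sub, ← Finset.sum_sub_distrib, Finset.mul_sum, Finset.mul_sum]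
  refine Finset.sum_congr rfl fun c _ => ?_
  have h1 := hC.2.2 l k j c
  have h2 := hC.swap_right l j c k
  have h3 := hC.swap_right l c k j
  have h4 := hC.2.1 l c j k
  have h5 := hC.swap_right j k l c
  linear_combination 4 * x c * (h1 - h2 - 2 * h3 + 3 * h4 + 3 * h5)

lemma alt3_Nij {m : ℕ} {C : Fin m → Fin m → Fin m → Fin m → ℝ} (hC : IsACT C)
    (x : Fin m → ℝ) (i j k : Fin m) :
    alt3 (fun i' j' k' => ∑ l, Nij C x l i' j' * (if k' = l then (1:ℝ) else 0)) i j k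
      = 48 * trilin (fun p q r =>
          alt3 (fun i' j' k' => ∑ l, C l p q i' * C j' k' r l) i j k) x x x := by
  have hT : ∀ i j k, trilin (fun p q r => ∑ l, C l p q i * C j k r l) x x x
      = ∑ l, (∑ a, ∑ b, C l a b i * x a * x b) * ∑ c, C j k c l * x c := by
    intro i j k
    simp only [trilin, Finset.sum_mul]
    simp only [Finset.mul_sum]
    symm
    rw [Finset.sum_comm]
    refine Finset.sum_congr rfl fun a _ => ?_
    rw [Finset.sum_comm]
    refine Finset.sum_congr rfl fun b _ => ?_
    rw [Finset.sum_comm]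
    refine Finset.sum_congr rfl fun c _ => Finset.sum_congr rfl fun l _ => ?_
    ring
  have hA : trilin (fun p q r =>
        alt3 (fun i' j' k' => ∑ l, C l p q i' * C j' k' r l) i j k) x x x
      = alt3 (fun i' j' k' => trilin (fun p q r => ∑ l, C l p q i' * C j' k' r l) x x x) i j k := by
    simp only [trilin, alt3, add_mul, sub_mul, Finset.sum_add_distrib, Finset.sum_sub_distrib]
  have hN : ∀ i j k, Nij C x k i j
      = ∑ l, (48 * ((∑ a, ∑ b, C l a b k * x a * x b) * ∑ c, C i j c l * x c)
        + Kf C x l i * pd (fun y => Kf C y k j) l x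
        - Kf C x l j * pd (fun y => Kf C y k i) l x) := by
    intro i j k
    unfold Nij
    refine Finset.sum_congr rfl fun l _ => ?_
    rw [pd_Kf_sub hC, Kf_eq_neg hC x k l]
    ring
  have hS : ∀ i j l, pd (fun y => Kf C y i j) l x = pd (fun y => Kf C y j i) l x := by
    intro i j l
    simp only [Kf_symm hC _ i j]
  rw [hA]
  simp only [hT, mul_ite, mul_one, mul_zero, Finset.sum_ite_eq, Finset.mem_univ, if_true, alt3, hN,
    ← Finset.sum_add_distrib, ← Finset.sum_sub_distrib, Finset.mul_sum (a := (48 : ℝ))]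
  refine Finset.sum_congr rfl fun l _ => ?_
  rw [hS j i, hS k i, hS k j]
  ring

/-- The first Tonolo–Schouten–Nijenhuis condition
`Alt_{[i,j,k]} Σₗ N^ℓ_{ij} δ_{kℓ} = 0` for `K^i_j(x) = 4 C_{ikjl} xₖ xₗ` holds
identically on `ℝ^m` iff the algebraic curvature tensor `C` satisfies (T1). -/
theorem first_TSN_iff_T1 {m : ℕ} (hm : 2 ≤ m)
    (C : Fin m → Fin m → Fin m → Fin m → ℝ) (hC : IsACT C) :
    (∀ (x : Fin m → ℝ) (i j k : Fin m),
      alt3 (fun i' j' k' =>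
        ∑ l, Nij C x l i' j' * (if k' = l then (1:ℝ) else 0)) i j k = 0) ↔
    T1 C := by
  simp only [alt3_Nij hC, mul_eq_zero, OfNat.ofNat_ne_zero, false_or]
  constructor
  · intro h p q r i j k
    exact (trilin_diag_eq_zero_iff _).1 (fun x => h x i j k) p q r
  · intro h x i j k
    exact (trilin_diag_eq_zero_iff _).2 (fun p q r => h p q r i j k) x
end

section
/- Let m ≥ 2 and let C be an algebraic curvature tensor on ℝ^m satisfying condition (T1): Sym_{(p,q,r)} Alt_{[i,j,k]} Σ_ℓ C_{ℓpqi} C_{jkrℓ} = 0, and condition (T2): Sym_{(p,q,r,s,t)} Alt_{[i,j,k]} Σ_{ℓ,m} ( C_{ℓpqm} C_{ℓrij} C_{kstm} − 2 C_{ℓpqi} C_{jℓrm} C_{kstm} ) = 0, for all free indices. Then C also satisfies the third Tonolo–Schouten–Nijenhuis condition (T3): Sym_{(p,q,r,s,t,u,v)} Alt_{[i,j,k]} Σ_{ℓ,m,n} ( 3 C_{ℓpqm} C_{ℓrns} C_{ntij} C_{kuvm} + 2 C_{ℓpqm} C_{nrsi} C_{jtnℓ} C_{kuvm} + 2 C_{ℓpqm}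 C_{nrsi} C_{jntℓ} C_{kuvm} ) = 0 for all free indices p,q,r,s,t,u,v,i,j,k. -/
/-- Sum over all permutations of five indices. -/
noncomputable def sym5 {m : ℕ} (F : (Fin 5 → Fin m) → ℝ) (v : Fin 5 → Fin m) : ℝ :=
  ∑ σ : Equiv.Perm (Fin 5), F (v ∘ σ)

/-- Sum over all permutations of seven indices. -/
noncomputable def sym7 {m : ℕ} (F : (Fin 7 → Fin m) → ℝ) (v : Fin 7 → Fin m) : ℝ :=
  ∑ σ : Equiv.Perm (Fin 7), F (v ∘ σ)

/-- Condition (T2): `Sym_{(p,q,r,s,t)} Alt_{[i,j,k]} Σ_{ℓ,m}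
( C_{ℓpqm} C_{ℓrij} C_{kstm} − 2 C_{ℓpqi} C_{jℓrm} C_{kstm} ) = 0`. -/
def T2 {m : ℕ} (C : Fin m → Fin m → Fin m → Fin m → ℝ) : Prop :=
  ∀ p q r s t i j k : Fin m,
    sym5 (fun w =>
      alt3 (fun i' j' k' => ∑ l, ∑ a,
        (C l (w 0) (w 1) a * C l (w 2) i' j' * C k' (w 3) (w 4) a
          - 2 * C l (w 0) (w 1) i' * C j' l (w 2) a * C k' (w 3) (w 4) a)) i j k)
      ![p, q, r, s, t] = 0

/-- The value on the diagonal at `x` of the multilinear form with coefficients `F`. -/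
noncomputable def diagEval {m n : ℕ} (x : Fin m → ℝ) (F : (Fin n → Fin m) → ℝ) : ℝ :=
  ∑ w, F w * ∏ a, x (w a)

section diagEval

variable {m n : ℕ} (x : Fin m → ℝ)

/-- A symmetrized coefficient array vanishes if the associated form vanishes on the diagonal. -/
theorem sum_perm_eq_zero_of_diagEval {F : (Fin n → Fin m) → ℝ}
    (h : ∀ x, diagEval x F = 0) (v : Fin n → Fin m) :
    ∑ σ : Equiv.Perm (Fin n), F (v ∘ σ) = 0 := by
  let f : (Fin m → ℝ) [×n]→L[ℝ] ℝ := ∑ w : Fin n → Fin m,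
    F w • (ContinuousMultilinearMap.mkPiAlgebra ℝ (Fin n) ℝ).compContinuousLinearMap
      (fun a => ContinuousLinearMap.proj (R := ℝ) (φ := fun _ : Fin m => ℝ) (w a))
  have hf : ∀ y : Fin n → Fin m → ℝ, f y = ∑ w, F w * ∏ a, y a (w a) := fun y => by
    simp [f]
  have hdiag : (fun y : Fin m → ℝ => f fun _ => y) = fun _ => 0 := by
    funext y
    rw [hf]
    exact h y
  have hsum := f.iteratedFDeriv_comp_diagonal 0 (fun i => Pi.single (v i) 1)
  rw [hdiag] at hsum
  have hsingle : ∀ u : Fin n → Fin m, f (fun i => Pi.single (u i) 1) = F u := fun u => by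
    rw [hf, Finset.sum_eq_single u]
    · simp
    · intro w _ hw
      obtain ⟨a, ha⟩ := Function.ne_iff.mp hw
      rw [Finset.prod_eq_zero (Finset.mem_univ a) (by simp [ha]), mul_zero]
    · simp
  rw [iteratedFDeriv_fun_zero] at hsum
  calc ∑ σ : Equiv.Perm (Fin n), F (v ∘ σ)
      = ∑ σ : Equiv.Perm (Fin n), f (fun i => Pi.single (v (σ i)) 1) :=
        Finset.sum_congr rfl fun σ _ => (hsingle (v ∘ σ)).symm
    _ = 0 := by rw [← hsum]; rfl

theorem diagEval_comp_perm (F : (Fin n → Fin m) → ℝ) (σ : Equiv.Perm (Fin n)) :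
    diagEval x (fun w => F (w ∘ σ)) = diagEval x F := by
  refine Fintype.sum_equiv (σ.symm.arrowCongr (Equiv.refl _)) _ _ fun w => ?_
  congr 1
  exact (Equiv.prod_comp σ fun a => x (w a)).symm

/-- A form whose symmetrized coefficient array vanishes is zero on the diagonal. -/
theorem diagEval_eq_zero_of_sum_perm {F : (Fin n → Fin m) → ℝ}
    (h : ∀ v : Fin n → Fin m, ∑ σ : Equiv.Perm (Fin n), F (v ∘ σ) = 0) :
    diagEval x F = 0 := by
  have key : ∑ σ : Equiv.Perm (Fin n), diagEval x (fun w => F (w ∘ σ)) = 0 := by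
    simp only [diagEval]
    rw [Finset.sum_comm]
    simp [← Finset.sum_mul, h]
  simp only [diagEval_comp_perm, Finset.sum_const, nsmul_eq_mul] at key
  exact (mul_eq_zero.mp key).resolve_left (by simp)

theorem diagEval_zero (F : (Fin 0 → Fin m) → ℝ) : diagEval x F = F ![] := by
  simp [diagEval, Subsingleton.elim default (![] : Fin 0 → Fin m)]

theorem diagEval_succ (F : (Fin (n + 1) → Fin m) → ℝ) :
    diagEval x F = ∑ a, x a * diagEval x (fun w => F (Matrix.vecCons a w)) := by
  simp only [diagEval, Finset.mul_sum]
  rw [← (Fin.consEquiv fun _ => Fin m).sum_comp, Fintype.sum_prod_type]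
  refine Finset.sum_congr rfl fun a _ => Finset.sum_congr rfl fun w _ => ?_
  simp only [Fin.consEquiv, Equiv.coe_fn_mk, Fin.prod_univ_succ, Fin.cons_zero, Fin.cons_succ,
    Matrix.vecCons]
  ring

theorem diagEval_add (F G : (Fin n → Fin m) → ℝ) :
    diagEval x (fun w => F w + G w) = diagEval x F + diagEval x G := by
  simp only [diagEval, add_mul, Finset.sum_add_distrib]

theorem diagEval_sub (F G : (Fin n → Fin m) → ℝ) :
    diagEval x (fun w => F w - G w) = diagEval x F - diagEval x G := by
  simp only [diagEval, sub_mul, Finset.sum_sub_distrib]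

theorem diagEval_const_mul (c : ℝ) (F : (Fin n → Fin m) → ℝ) :
    diagEval x (fun w => c * F w) = c * diagEval x F := by
  simp only [diagEval, mul_assoc, Finset.mul_sum]

theorem diagEval_sum {ι : Type*} [Fintype ι] (F : ι → (Fin n → Fin m) → ℝ) :
    diagEval x (fun w => ∑ i, F i w) = ∑ i, diagEval x (F i) := by
  simp only [diagEval, Finset.sum_mul]
  exact Finset.sum_comm

theorem diagEval_alt3 {α : Type*} (F : (Fin n → Fin m) → α → α → α → ℝ) (i j k : α) :
    diagEval x (fun w => alt3 (F w) i j k) =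
      alt3 (fun i j k => diagEval x (fun w => F w i j k)) i j k := by
  simp only [alt3, diagEval_add, diagEval_sub]

theorem sum_mul_const_mul (c : ℝ) (F : Fin m → ℝ) :
    ∑ a, x a * (c * F a) = c * ∑ a, x a * F a := by
  simp only [mul_left_comm (x _) c, Finset.mul_sum]

theorem sum_mul_mul_const (c : ℝ) (F : Fin m → ℝ) :
    ∑ a, x a * (F a * c) = (∑ a, x a * F a) * c := by
  simp only [← mul_assoc, Finset.sum_mul]

theorem diagEval_two_one (A : Fin m → Fin m → ℝ) (B : Fin m → ℝ) :
    diagEval x (fun w : Fin 3 → Fin m => A (w 0) (w 1) * B (w 2)) =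
      (∑ a, x a * ∑ b, x b * A a b) * ∑ a, x a * B a := by
  simp only [diagEval_succ, diagEval_zero, Matrix.cons_val]
  simp only [sum_mul_const_mul, sum_mul_mul_const]

theorem diagEval_two_one_two (A D : Fin m → Fin m → ℝ) (B : Fin m → ℝ) :
    diagEval x (fun w : Fin 5 → Fin m => A (w 0) (w 1) * B (w 2) * D (w 3) (w 4)) =
      (∑ a, x a * ∑ b, x b * A a b) * (∑ a, x a * B a) * ∑ a, x a * ∑ b, x b * D a b := by
  simp only [diagEval_succ, diagEval_zero, Matrix.cons_val]
  simp only [sum_mul_const_mul, sum_mul_mul_const]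

theorem diagEval_two_two_one_two (A B E : Fin m → Fin m → ℝ) (D : Fin m → ℝ) :
    diagEval x (fun w : Fin 7 → Fin m =>
      A (w 0) (w 1) * B (w 2) (w 3) * D (w 4) * E (w 5) (w 6)) =
      (∑ a, x a * ∑ b, x b * A a b) * (∑ a, x a * ∑ b, x b * B a b) * (∑ a, x a * D a) *
        ∑ a, x a * ∑ b, x b * E a b := by
  simp only [diagEval_succ, diagEval_zero, Matrix.cons_val]
  simp only [sum_mul_const_mul, sum_mul_mul_const]

end diagEval

theorem sym7_eq_zero_of_diagEval {m : ℕ} {F : (Fin 7 → Fin m) → ℝ}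
    (h : ∀ x, diagEval x F = 0) (v : Fin 7 → Fin m) : sym7 F v = 0 :=
  sum_perm_eq_zero_of_diagEval h v

theorem diagEval_eq_zero_of_sym5 {m : ℕ} (x : Fin m → ℝ) {F : (Fin 5 → Fin m) → ℝ}
    (h : ∀ p q r s t, sym5 F ![p, q, r, s, t] = 0) : diagEval x F = 0 :=
  diagEval_eq_zero_of_sum_perm x fun v => by
    have hv : v = ![v 0, v 1, v 2, v 3, v 4] := by ext a; fin_cases a <;> rfl
    rw [hv]
    exact h _ _ _ _ _

theorem sym3_eq_sum_perm {m : ℕ} (F : Fin m → Fin m → Fin m → ℝ) (v : Fin 3 → Fin m) :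
    sym3 F (v 0) (v 1) (v 2) =
      ∑ σ : Equiv.Perm (Fin 3), (fun w : Fin 3 → Fin m => F (w 0) (w 1) (w 2)) (v ∘ σ) := by
  have huniv : (Finset.univ : Finset (Equiv.Perm (Fin 3))) =
      {1, c[1, 2], c[0, 1], c[0, 1, 2], c[0, 2, 1], c[0, 2]} := by decide
  rw [huniv]
  repeat rw [Finset.sum_insert (by decide)]
  rw [Finset.sum_singleton]
  simp only [sym3, Function.comp_apply, add_assoc]
  rfl

theorem diagEval_eq_zero_of_sym3 {m : ℕ} (x : Fin m → ℝ) {F : Fin m → Fin m → Fin m → ℝ}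
    (h : ∀ p q r, sym3 F p q r = 0) :
    diagEval x (fun w : Fin 3 → Fin m => F (w 0) (w 1) (w 2)) = 0 :=
  diagEval_eq_zero_of_sum_perm x fun v => (sym3_eq_sum_perm F v).symm.trans (h _ _ _)

/-- The trilinear form with coefficients `Θ`. -/
noncomputable def triForm {m : ℕ} (Θ : Fin m → Fin m → Fin m → ℝ) (u v w : Fin m → ℝ) : ℝ :=
  ∑ i, ∑ j, ∑ k, u i * v j * w k * Θ i j k

section triForm

variable {m : ℕ} (Θ : Fin m → Fin m → Fin m → ℝ) (u v w : Fin m → ℝ)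

open Matrix in
theorem triForm_mulVec_left (R : Fin m → Fin m → ℝ) :
    triForm Θ (of R *ᵥ u) v w = triForm (fun i j k => ∑ l, R l i * Θ l j k) u v w := by
  simp only [triForm, mulVec, dotProduct, of_apply, Finset.sum_mul, Finset.mul_sum]
  rw [Finset.sum_congr rfl fun _ _ => Finset.sum_congr rfl fun _ _ => Finset.sum_comm]
  rw [Finset.sum_congr rfl fun _ _ => Finset.sum_comm, Finset.sum_comm]
  refine Finset.sum_congr rfl fun i _ => ?_
  rw [Finset.sum_comm]
  refine Finset.sum_congr rfl fun j _ => ?_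
  rw [Finset.sum_comm]
  exact Finset.sum_congr rfl fun k _ => Finset.sum_congr rfl fun l _ => by ring

theorem triForm_rotate : triForm Θ v w u = triForm (fun i j k => Θ j k i) u v w := by
  simp only [triForm]
  rw [Finset.sum_congr rfl fun _ _ => Finset.sum_comm, Finset.sum_comm]
  exact Finset.sum_congr rfl fun i _ => Finset.sum_congr rfl fun j _ =>
    Finset.sum_congr rfl fun k _ => by ring

theorem triForm_swap : triForm Θ u w v = triForm (fun i j k => Θ i k j) u v w := by
  simp only [triForm]
  refine Finset.sum_congr rfl fun i _ => ?_
  rw [Finset.sum_comm]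
  exact Finset.sum_congr rfl fun j _ => Finset.sum_congr rfl fun k _ => by ring

theorem triForm_add (Φ : Fin m → Fin m → Fin m → ℝ) :
    triForm Θ u v w + triForm Φ u v w = triForm (fun i j k => Θ i j k + Φ i j k) u v w := by
  simp only [triForm, mul_add, Finset.sum_add_distrib]

theorem triForm_single (i j k : Fin m) :
    triForm Θ (Pi.single i 1) (Pi.single j 1) (Pi.single k 1) = Θ i j k := by
  simp only [triForm]
  rw [Finset.sum_eq_single i, Finset.sum_eq_single j, Finset.sum_eq_single k] <;> simp +contextual

theorem triForm_eq_zero (h : ∀ i j k, Θ i j k = 0) : triForm Θ u v w = 0 := by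
  simp [triForm, h]

open Matrix in
theorem triForm_mulVec_middle (R : Fin m → Fin m → ℝ) :
    triForm Θ u (of R *ᵥ v) w = triForm (fun i j k => ∑ l, R l j * Θ i l k) u v w := by
  rw [← triForm_rotate (fun i j k => Θ k i j), triForm_mulVec_left, triForm_rotate]

open Matrix in
theorem triForm_mulVec_right (R : Fin m → Fin m → ℝ) :
    triForm Θ u v (of R *ᵥ w) = triForm (fun i j k => ∑ l, R l k * Θ i j l) u v w := by
  rw [triForm_rotate, triForm_mulVec_left, ← triForm_rotate]

end triForm

/-- A consequence of the Bianchi identity and two cyclic identities for a function `T`,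
antisymmetric in its last two arguments, and a map `R`. -/
theorem cyclic_cubic_identity {E : Type*} (T : E → E → E → ℝ) (R : E → E)
    (anti : ∀ u v w, T u w v = - T u v w)
    (bianchi : ∀ u v w, T u v w + T v w u + T w u v = 0)
    (first : ∀ u v w, T (R u) v w + T (R v) w u + T (R w) u v = 0)
    (second : ∀ u v w, T (R (R u)) v w + T u (R v) (R w) + (T (R (R v)) w u + T v (R w) (R u))
      + (T (R (R w)) u v + T w (R u) (R v)) = 0) (u v w : E) :
    alt3 (fun a b c => -(3 * T (R (R (R c))) a b) + 2 * T b (R a) (R (R c))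
      - 2 * T (R (R c)) b (R a)) u v w = 0 := by
  simp only [alt3]
  linarith [bianchi u v (R (R (R w))), anti u v (R (R (R w))), anti v (R (R (R w))) u,
    anti (R (R (R w))) u v, bianchi u (R v) (R (R w)), anti u (R v) (R (R w)),
    anti (R v) (R (R w)) u, anti (R (R w)) u (R v), bianchi u (R (R v)) (R w),
    anti u (R (R v)) (R w), anti (R (R v)) (R w) u, anti (R w) u (R (R v)),
    bianchi u (R (R (R v))) w, anti u (R (R (R v))) w, anti (R (R (R v))) w u,
    anti w u (R (R (R v))), bianchi (R u) v (R (R w)), anti (R u) v (R (R w)),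
    anti v (R (R w)) (R u), anti (R (R w)) (R u) v, bianchi (R u) (R v) (R w),
    anti (R u) (R v) (R w), anti (R v) (R w) (R u), anti (R w) (R u) (R v),
    bianchi (R u) (R (R v)) w, anti (R u) (R (R v)) w, anti (R (R v)) w (R u),
    anti w (R u) (R (R v)), bianchi (R (R u)) v (R w), anti (R (R u)) v (R w),
    anti v (R w) (R (R u)), anti (R w) (R (R u)) v, bianchi (R (R u)) (R v) w,
    anti (R (R u)) (R v) w, anti (R v) w (R (R u)), anti w (R (R u)) (R v),
    bianchi (R (R (R u))) v w, anti (R (R (R u))) v w, anti v w (R (R (R u))),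
    anti w (R (R (R u))) v, first u v (R (R w)), first u (R v) (R w), first u (R (R v)) w,
    first (R u) v (R w), first (R u) (R v) w, first (R (R u)) v w, second (R u) v w,
    second u (R v) w, second u v (R w)]

/-- `Φ` is given by a coefficient array. -/
def IsTriForm {m : ℕ} (Φ : (Fin m → ℝ) → (Fin m → ℝ) → (Fin m → ℝ) → ℝ) : Prop :=
  ∃ Θ, ∀ u v w, Φ u v w = triForm Θ u v w

namespace IsTriForm

variable {m : ℕ} {Φ Ψ : (Fin m → ℝ) → (Fin m → ℝ) → (Fin m → ℝ) → ℝ}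

theorem add (hΦ : IsTriForm Φ) (hΨ : IsTriForm Ψ) :
    IsTriForm fun u v w => Φ u v w + Ψ u v w := by
  obtain ⟨Θ, hΘ⟩ := hΦ
  obtain ⟨Ξ, hΞ⟩ := hΨ
  exact ⟨_, fun u v w => by beta_reduce; rw [hΘ, hΞ, triForm_add]⟩

theorem rotate (hΦ : IsTriForm Φ) : IsTriForm fun u v w => Φ v w u := by
  obtain ⟨Θ, hΘ⟩ := hΦ
  exact ⟨_, fun u v w => by beta_reduce; rw [hΘ, triForm_rotate]⟩

open Matrix in
theorem mulVec_left (hΦ : IsTriForm Φ) (R : Fin m → Fin m → ℝ) :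
    IsTriForm fun u v w => Φ (of R *ᵥ u) v w := by
  obtain ⟨Θ, hΘ⟩ := hΦ
  exact ⟨_, fun u v w => by beta_reduce; rw [hΘ, triForm_mulVec_left]⟩

open Matrix in
theorem mulVec_middle (hΦ : IsTriForm Φ) (R : Fin m → Fin m → ℝ) :
    IsTriForm fun u v w => Φ u (of R *ᵥ v) w := by
  obtain ⟨Θ, hΘ⟩ := hΦ
  exact ⟨_, fun u v w => by beta_reduce; rw [hΘ, triForm_mulVec_middle]⟩

open Matrix in
theorem mulVec_right (hΦ : IsTriForm Φ) (R : Fin m → Fin m → ℝ) :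
    IsTriForm fun u v w => Φ u v (of R *ᵥ w) := by
  obtain ⟨Θ, hΘ⟩ := hΦ
  exact ⟨_, fun u v w => by beta_reduce; rw [hΘ, triForm_mulVec_right]⟩

theorem eq_zero_of_single (hΦ : IsTriForm Φ)
    (h : ∀ i j k, Φ (Pi.single i 1) (Pi.single j 1) (Pi.single k 1) = 0) (u v w : Fin m → ℝ) :
    Φ u v w = 0 := by
  obtain ⟨Θ, hΘ⟩ := hΦ
  rw [hΘ]
  exact triForm_eq_zero _ _ _ _ fun i j k => by rw [← triForm_single Θ, ← hΘ, h]

end IsTriForm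

/-- The contraction `C_{l x x i}`. -/
noncomputable def jacobiMat {m : ℕ} (C : Fin m → Fin m → Fin m → Fin m → ℝ) (x : Fin m → ℝ)
    (l i : Fin m) : ℝ :=
  ∑ a, x a * ∑ b, x b * C l a b i

/-- The contraction `C_{i x j k}`. -/
noncomputable def contractSnd {m : ℕ} (C : Fin m → Fin m → Fin m → Fin m → ℝ) (x : Fin m → ℝ)
    (i j k : Fin m) : ℝ :=
  ∑ a, x a * C i a j k

namespace IsACT

variable {m : ℕ} {C : Fin m → Fin m → Fin m → Fin m → ℝ}

theorem antisymm_right (hC : IsACT C) (i j k l : Fin m) : C i j k l = - C i j l k := by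
  rw [hC.2.1, hC.1, hC.2.1 l]

theorem jacobiMat_comm (hC : IsACT C) (x : Fin m → ℝ) (i j : Fin m) :
    jacobiMat C x i j = jacobiMat C x j i := by
  simp only [jacobiMat, Finset.mul_sum]
  rw [Finset.sum_comm]
  refine Finset.sum_congr rfl fun a _ => Finset.sum_congr rfl fun b _ => ?_
  rw [hC.2.1 i b a j, hC.1 a j i b, hC.antisymm_right j a i b]
  ring

theorem contractSnd_antisymm (hC : IsACT C) (x : Fin m → ℝ) (i j k : Fin m) :
    contractSnd C x i k j = - contractSnd C x i j k := by
  simp only [contractSnd, ← Finset.sum_neg_distrib]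
  exact Finset.sum_congr rfl fun a _ => by rw [hC.antisymm_right]; ring

theorem contractSnd_bianchi (hC : IsACT C) (x : Fin m → ℝ) (i j k : Fin m) :
    contractSnd C x i j k + contractSnd C x j k i + contractSnd C x k i j = 0 := by
  simp only [contractSnd, ← Finset.sum_add_distrib]
  refine Finset.sum_eq_zero fun a _ => ?_
  rw [hC.1 i, hC.1 j, hC.1 k]
  linear_combination -x a * hC.2.2 a i j k

theorem contract_third (hC : IsACT C) (x : Fin m → ℝ) (i j k : Fin m) :
    ∑ a, x a * C j k a i = - contractSnd C x i j k := by
  simp only [contractSnd, ← Finset.sum_neg_distrib]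
  exact Finset.sum_congr rfl fun a _ => by rw [hC.2.1, hC.1]; ring

theorem contract_snd_fourth (hC : IsACT C) (x : Fin m → ℝ) (i j : Fin m) :
    ∑ a, x a * ∑ b, x b * C i a j b = - jacobiMat C x i j := by
  simp only [jacobiMat, ← Finset.sum_neg_distrib, Finset.mul_sum]
  exact Finset.sum_congr rfl fun a _ => Finset.sum_congr rfl fun b _ => by
    rw [hC.antisymm_right]; ring

open Matrix in
theorem first_contracted (hC : IsACT C) (x : Fin m → ℝ) (hT1 : T1 C) (u v w : Fin m → ℝ) :
    triForm (contractSnd C x) (of (jacobiMat C x) *ᵥ u) v w +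
      triForm (contractSnd C x) (of (jacobiMat C x) *ᵥ v) w u +
      triForm (contractSnd C x) (of (jacobiMat C x) *ᵥ w) u v = 0 := by
  have contract_anti := hC.contractSnd_antisymm x
  set T := contractSnd C x
  set R := jacobiMat C x
  have base : IsTriForm fun u v w => triForm T (of R *ᵥ u) v w :=
    ⟨_, fun u v w => triForm_mulVec_left T u v w R⟩
  refine ((base.add base.rotate).add base.rotate.rotate).eq_zero_of_single (fun i j k => ?_) u v w
  have h := diagEval_eq_zero_of_sym3 x fun p q r => hT1 p q r i j k
  rw [diagEval_alt3] at h
  simp only [diagEval_sum] at h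
  have hterm : ∀ i j k l, diagEval x (fun w : Fin 3 → Fin m => C l (w 0) (w 1) i * C j k (w 2) l) =
      R l i * - T l j k := fun i j k l => by
    rw [diagEval_two_one x (fun a b => C l a b i) (fun a => C j k a l), hC.contract_third]
    rfl
  simp only [hterm] at h
  have hanti : ∀ i j k, ∑ l, R l i * - T l k j = - ∑ l, R l i * - T l j k := fun i j k => by
    rw [← Finset.sum_neg_distrib]
    exact Finset.sum_congr rfl fun l _ => by rw [contract_anti]; ring
  have hneg : ∀ i j k, ∑ l, R l i * - T l j k = - ∑ l, R l i * T l j k := fun i j k => by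
    simp
  simp only [alt3] at h
  simp only [triForm_mulVec_left, triForm_single]
  linarith [hanti i j k, hanti j k i, hanti k i j, hneg i j k, hneg j k i, hneg k i j]

theorem triForm_antisymm (hC : IsACT C) (x : Fin m → ℝ) (u v w : Fin m → ℝ) :
    triForm (contractSnd C x) u w v = - triForm (contractSnd C x) u v w := by
  rw [triForm_swap, eq_neg_iff_add_eq_zero, triForm_add]
  exact triForm_eq_zero _ _ _ _ fun i j k => by rw [hC.contractSnd_antisymm]; ring

theorem triForm_bianchi (hC : IsACT C) (x : Fin m → ℝ) (u v w : Fin m → ℝ) :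
    triForm (contractSnd C x) u v w + triForm (contractSnd C x) v w u +
      triForm (contractSnd C x) w u v = 0 := by
  have base : IsTriForm (triForm (contractSnd C x)) := ⟨_, fun _ _ _ => rfl⟩
  refine ((base.add base.rotate).add base.rotate.rotate).eq_zero_of_single (fun i j k => ?_) u v w
  simp only [triForm_single]
  exact hC.contractSnd_bianchi x i j k

open Matrix in
theorem second_contracted (hC : IsACT C) (x : Fin m → ℝ) (hT2 : T2 C) (u v w : Fin m → ℝ) :
    triForm (contractSnd C x) (of (jacobiMat C x) *ᵥ (of (jacobiMat C x) *ᵥ u)) v w +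
      triForm (contractSnd C x) u (of (jacobiMat C x) *ᵥ v) (of (jacobiMat C x) *ᵥ w) +
      (triForm (contractSnd C x) (of (jacobiMat C x) *ᵥ (of (jacobiMat C x) *ᵥ v)) w u +
      triForm (contractSnd C x) v (of (jacobiMat C x) *ᵥ w) (of (jacobiMat C x) *ᵥ u)) +
      (triForm (contractSnd C x) (of (jacobiMat C x) *ᵥ (of (jacobiMat C x) *ᵥ w)) u v +
      triForm (contractSnd C x) w (of (jacobiMat C x) *ᵥ u) (of (jacobiMat C x) *ᵥ v)) = 0 := by
  have anti := hC.triForm_antisymm x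
  have bianchi := hC.triForm_bianchi x
  have comm := hC.jacobiMat_comm x
  set T := contractSnd C x
  set R := jacobiMat C x
  have id_form : IsTriForm (triForm T) := ⟨T, fun _ _ _ => rfl⟩
  have base := ((id_form.mulVec_left R).mulVec_left R).add
    ((id_form.mulVec_middle R).mulVec_right R)
  refine ((base.add base.rotate).add base.rotate.rotate).eq_zero_of_single (fun i j k => ?_) u v w
  have h := diagEval_eq_zero_of_sym5 x fun p q r s t => hT2 p q r s t i j k
  rw [diagEval_alt3] at h
  have hterm : ∀ i j k, diagEval x (fun w : Fin 5 → Fin m => ∑ l, ∑ a,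
      (C l (w 0) (w 1) a * C l (w 2) i j * C k (w 3) (w 4) a
        - 2 * C l (w 0) (w 1) i * C j l (w 2) a * C k (w 3) (w 4) a)) =
      triForm T (of R *ᵥ (of R *ᵥ Pi.single k 1)) (Pi.single i 1) (Pi.single j 1) +
      2 * triForm T (of R *ᵥ Pi.single k 1) (Pi.single j 1) (of R *ᵥ Pi.single i 1) := by
    intro i j k
    rw [triForm_mulVec_left, triForm_mulVec_left, triForm_single, triForm_mulVec_left,
      triForm_mulVec_right, triForm_single]
    have h1 : ∀ l a, diagEval x (fun w : Fin 5 → Fin m =>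
        C l (w 0) (w 1) a * C l (w 2) i j * C k (w 3) (w 4) a) = R l a * T l i j * R k a :=
      fun l a => diagEval_two_one_two x (fun p q => C l p q a) (fun p q => C k p q a)
        (fun p => C l p i j)
    have h2 : ∀ l a, diagEval x (fun w : Fin 5 → Fin m =>
        2 * C l (w 0) (w 1) i * C j l (w 2) a * C k (w 3) (w 4) a) =
        2 * (R l i * - T a j l * R k a) :=
      fun l a => by
        simp only [mul_assoc (2 : ℝ), diagEval_const_mul]
        rw [diagEval_two_one_two x (fun p q => C l p q i) (fun p q => C k p q a)
            (fun p => C j l p a),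
          hC.contract_third]
        rfl
    simp only [diagEval_sum, diagEval_sub, h1, h2, Finset.sum_sub_distrib, Finset.mul_sum, comm k]
    rw [sub_eq_add_neg, ← Finset.sum_neg_distrib]
    simp only [← Finset.sum_neg_distrib]
    congr 1
    · rw [Finset.sum_comm]
      exact Finset.sum_congr rfl fun l _ => Finset.sum_congr rfl fun a _ => by ring
    · exact Finset.sum_congr rfl fun l _ => Finset.sum_congr rfl fun a _ => by ring
  simp only [hterm, alt3] at h
  generalize (Pi.single i 1 : Fin m → ℝ) = a at *
  generalize (Pi.single j 1 : Fin m → ℝ) = b at *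
  generalize (Pi.single k 1 : Fin m → ℝ) = c at *
  linarith [anti (of R *ᵥ (of R *ᵥ a)) b c, anti (of R *ᵥ (of R *ᵥ b)) c a,
    anti (of R *ᵥ (of R *ᵥ c)) a b, bianchi a (of R *ᵥ b) (of R *ᵥ c),
    bianchi b (of R *ᵥ c) (of R *ᵥ a), bianchi c (of R *ᵥ a) (of R *ᵥ b),
    anti (of R *ᵥ a) b (of R *ᵥ c), anti (of R *ᵥ b) c (of R *ᵥ a),
    anti (of R *ᵥ c) a (of R *ᵥ b), anti (of R *ᵥ a) c (of R *ᵥ b),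
    anti (of R *ᵥ b) a (of R *ᵥ c), anti (of R *ᵥ c) b (of R *ᵥ a)]

open Matrix in
/-- The contraction of the expression in the third condition. -/
theorem third_contracted (hC : IsACT C) (x : Fin m → ℝ) (i j k : Fin m) :
    diagEval x (fun w : Fin 7 → Fin m => ∑ l, ∑ a, ∑ n,
      (3 * C l (w 0) (w 1) a * C l (w 2) n (w 3) * C n (w 4) i j * C k (w 5) (w 6) a
        + 2 * C l (w 0) (w 1) a * C n (w 2) (w 3) i * C j (w 4) n l * C k (w 5) (w 6) a
        + 2 * C l (w 0) (w 1) a * C n (w 2) (w 3) i * C j n (w 4) l * C k (w 5) (w 6) a)) =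
    -(3 * triForm (contractSnd C x) (of (jacobiMat C x) *ᵥ (of (jacobiMat C x) *ᵥ
        (of (jacobiMat C x) *ᵥ Pi.single k 1))) (Pi.single i 1) (Pi.single j 1))
      + 2 * triForm (contractSnd C x) (Pi.single j 1) (of (jacobiMat C x) *ᵥ Pi.single i 1)
        (of (jacobiMat C x) *ᵥ (of (jacobiMat C x) *ᵥ Pi.single k 1))
      - 2 * triForm (contractSnd C x) (of (jacobiMat C x) *ᵥ (of (jacobiMat C x) *ᵥ
        Pi.single k 1)) (Pi.single j 1) (of (jacobiMat C x) *ᵥ Pi.single i 1) := by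
  have h1 : ∀ l a n, diagEval x (fun w : Fin 7 → Fin m =>
      C l (w 0) (w 1) a * C l (w 2) n (w 3) * C n (w 4) i j * C k (w 5) (w 6) a) =
      jacobiMat C x l a * - jacobiMat C x l n * contractSnd C x n i j * jacobiMat C x k a :=
    fun l a n => by
      rw [diagEval_two_two_one_two x (fun p q => C l p q a) (fun p q => C l p n q)
        (fun p q => C k p q a) (fun p => C n p i j), hC.contract_snd_fourth]
      rfl
  have h2 : ∀ l a n, diagEval x (fun w : Fin 7 → Fin m =>
      C l (w 0) (w 1) a * C n (w 2) (w 3) i * C j (w 4) n l * C k (w 5) (w 6) a) =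
      jacobiMat C x l a * jacobiMat C x n i * contractSnd C x j n l * jacobiMat C x k a :=
    fun l a n => diagEval_two_two_one_two x (fun p q => C l p q a) (fun p q => C n p q i)
        (fun p q => C k p q a) (fun p => C j p n l)
  have h3 : ∀ l a n, diagEval x (fun w : Fin 7 → Fin m =>
      C l (w 0) (w 1) a * C n (w 2) (w 3) i * C j n (w 4) l * C k (w 5) (w 6) a) =
      jacobiMat C x l a * jacobiMat C x n i * - contractSnd C x l j n * jacobiMat C x k a :=
    fun l a n => by
      rw [diagEval_two_two_one_two x (fun p q => C l p q a) (fun p q => C n p q i)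
        (fun p q => C k p q a) (fun p => C j n p l), hC.contract_third]
      rfl
  simp only [mul_assoc] at h1 h2 h3
  simp only [triForm_mulVec_left, triForm_mulVec_right, triForm_mulVec_middle, triForm_single]
  simp only [diagEval_sum, diagEval_add, mul_assoc, diagEval_const_mul, h1, h2, h3,
    Finset.sum_add_distrib, Finset.mul_sum, hC.jacobiMat_comm x k, sub_eq_add_neg,
    ← Finset.sum_neg_distrib]
  congr 1
  · congr 1
    · rw [Finset.sum_comm]
      exact Finset.sum_congr rfl fun a _ => Finset.sum_congr rfl fun l _ =>
        Finset.sum_congr rfl fun n _ => by rw [hC.jacobiMat_comm x n l]; ring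
    · symm
      rw [Finset.sum_comm, Finset.sum_congr rfl fun _ _ => Finset.sum_comm, Finset.sum_comm]
      exact Finset.sum_congr rfl fun l _ => Finset.sum_congr rfl fun a _ =>
        Finset.sum_congr rfl fun n _ => by ring
  · rw [Finset.sum_comm]
    exact Finset.sum_congr rfl fun a _ => Finset.sum_congr rfl fun l _ =>
      Finset.sum_congr rfl fun n _ => by ring

end IsACT

/-- If an algebraic curvature tensor on `ℝ^m` (`m ≥ 2`) satisfies the first and second
Tonolo–Schouten–Nijenhuis conditions (T1) and (T2), then it also satisfies the third
TSN condition (T3). -/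
theorem third_TSN_from_first_and_second {m : ℕ} (hm : 2 ≤ m)
    (C : Fin m → Fin m → Fin m → Fin m → ℝ) (hC : IsACT C)
    (hT1 : T1 C) (hT2 : T2 C) :
    ∀ p q r s t u v i j k : Fin m,
      sym7 (fun w =>
        alt3 (fun i' j' k' => ∑ l, ∑ a, ∑ n,
          (3 * C l (w 0) (w 1) a * C l (w 2) n (w 3) * C n (w 4) i' j' * C k' (w 5) (w 6) a
            + 2 * C l (w 0) (w 1) a * C n (w 2) (w 3) i' * C j' (w 4) n l * C k' (w 5) (w 6) a
            + 2 * C l (w 0) (w 1) a * C n (w 2) (w 3) i' * C j' n (w 4) l * C k' (w 5) (w 6) a))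
          i j k)
        ![p, q, r, s, t, u, v] = 0 := by
  intro p q r s t u v i j k
  refine sym7_eq_zero_of_diagEval (fun x => ?_) _
  rw [diagEval_alt3]
  simp only [hC.third_contracted x, alt3]
  exact cyclic_cubic_identity (triForm (contractSnd C x)) (Matrix.of (jacobiMat C x)).mulVec
    (hC.triForm_antisymm x) (hC.triForm_bianchi x) (hC.first_contracted x hT1)
    (hC.second_contracted x hT2) (Pi.single i 1) (Pi.single j 1) (Pi.single k 1)
end

section
/- Let m ≥ 2 and let C be an algebraic curvature tensor on ℝ^m satisfying condition (T1): Sym_{(p,q,r)} Alt_{[i,j,k]} Σ_ℓ C_{ℓpqi} C_{jkrℓ} = 0 for all indices. Then C satisfies the identity (T4): Sym_{(p,q,r,s,t)} Alt_{[i,j,k]} Σ_{ℓ,m} ( C_{ℓpqm} C_{ℓrij} C_{kstm} + 2 C_{ℓpqi} C_{jℓrm} C_{kstm} ) = 0 for all free indices p,q,r,s,t,i,j,k. -/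
/-- Permuting the five arguments does not change the symmetrization. -/
theorem sym5_comp_perm {m : ℕ} (F : (Fin 5 → Fin m) → ℝ) (v : Fin 5 → Fin m)
    (π : Equiv.Perm (Fin 5)) : sym5 (fun w => F (w ∘ π)) v = sym5 F v :=
  Equiv.sum_comp (Equiv.mulRight π) fun σ : Equiv.Perm (Fin 5) => F (v ∘ σ)

theorem sym5_add {m : ℕ} (F G : (Fin 5 → Fin m) → ℝ) (v : Fin 5 → Fin m) :
    sym5 (fun w => F w + G w) v = sym5 F v + sym5 G v :=
  Finset.sum_add_distrib

theorem sym5_sub {m : ℕ} (F G : (Fin 5 → Fin m) → ℝ) (v : Fin 5 → Fin m) :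
    sym5 (fun w => F w - G w) v = sym5 F v - sym5 G v :=
  Finset.sum_sub_distrib _ _

theorem sym5_const_mul {m : ℕ} (c : ℝ) (F : (Fin 5 → Fin m) → ℝ) (v : Fin 5 → Fin m) :
    sym5 (fun w => c * F w) v = c * sym5 F v :=
  (Finset.mul_sum _ _ _).symm

/-- A function whose symmetrization in the first three arguments vanishes has vanishing
symmetrization in all five arguments. -/
theorem sym5_eq_zero_of_sym3 {m : ℕ} (K : Fin m → Fin m → Fin m → Fin m → Fin m → ℝ)
    (hK : ∀ p q r s t, sym3 (fun p' q' r' => K p' q' r' s t) p q r = 0) (v : Fin 5 → Fin m) :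
    sym5 (fun w => K (w 0) (w 1) (w 2) (w 3) (w 4)) v = 0 := by
  set F : (Fin 5 → Fin m) → ℝ := fun w => K (w 0) (w 1) (w 2) (w 3) (w 4) with hF
  have hzero : sym5 (fun w => F w + F (w ∘ Equiv.swap 1 2) + F (w ∘ Equiv.swap 0 1)
      + F (w ∘ (Equiv.swap 0 1 * Equiv.swap 1 2 : Equiv.Perm (Fin 5)))
      + F (w ∘ (Equiv.swap 1 2 * Equiv.swap 0 1 : Equiv.Perm (Fin 5)))
      + F (w ∘ Equiv.swap 0 2)) v = 0 :=
    Finset.sum_eq_zero fun σ _ => hK _ _ _ _ _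
  simp only [sym5_add, sym5_comp_perm] at hzero
  linarith

/-- The contraction `Σ_{ℓ,a} C_{ℓpqa} C_{ℓrij} C_{ksta}`. -/
noncomputable def jacobiSqTerm {m : ℕ} (C : Fin m → Fin m → Fin m → Fin m → ℝ)
    (i j k : Fin m) (w : Fin 5 → Fin m) : ℝ :=
  ∑ l, ∑ a, C l (w 0) (w 1) a * C l (w 2) i j * C k (w 3) (w 4) a

/-- The contraction `Σ_{ℓ,a} C_{ℓpqi} C_{jℓra} C_{ksta}`. -/
noncomputable def jacobiMixedTerm {m : ℕ} (C : Fin m → Fin m → Fin m → Fin m → ℝ)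
    (i j k : Fin m) (w : Fin 5 → Fin m) : ℝ :=
  ∑ l, ∑ a, C l (w 0) (w 1) i * C j l (w 2) a * C k (w 3) (w 4) a

/-- The consequence of (T1) obtained by contracting one alternated index with `C_{asti}` and
symmetrizing. -/
theorem sym5_contracted_T1 {m : ℕ} {C : Fin m → Fin m → Fin m → Fin m → ℝ} (hC : IsACT C)
    (hT1 : T1 C) (i j k : Fin m) (v : Fin 5 → Fin m) :
    sym5 (jacobiMixedTerm C i j k) v - sym5 (jacobiMixedTerm C i k j) v
      + sym5 (jacobiSqTerm C j k i) v = 0 := by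
  obtain ⟨hanti, hpair, -⟩ := hC
  have hrev (a b c d : Fin m) : C a b c d = C d c b a := by
    rw [hpair, hanti, hpair, hanti, hpair, neg_neg]
  have hzero := sym5_eq_zero_of_sym3
    (fun p q r s t => ∑ a, C a s t i *
      alt3 (fun i' j' k' => ∑ l, C l p q i' * C j' k' r l) k j a)
    (fun p q r s t => by
      have h (a : Fin m) := congrArg (C a s t i * ·) (hT1 p q r k j a)
      simp only [sym3, mul_add, mul_zero] at h
      simp only [sym3, ← Finset.sum_add_distrib]
      exact Finset.sum_eq_zero fun a _ => h a) v
  let π : Equiv.Perm (Fin 5) :=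
    Equiv.swap 0 3 * Equiv.swap 1 4 * Equiv.swap 3 4
  have hexpand (w : Fin 5 → Fin m) :
      ∑ a, C a (w 3) (w 4) i *
        alt3 (fun i' j' k' => ∑ l, C l (w 0) (w 1) i' * C j' k' (w 2) l) k j a
      = 2 * (jacobiMixedTerm C i j k (w ∘ π) - jacobiMixedTerm C i k j (w ∘ π)
        + jacobiSqTerm C j k i (w ∘ Equiv.swap 3 4)) := by
    have h₁ : jacobiMixedTerm C i j k (w ∘ π) =
        ∑ a, ∑ l, C a (w 3) (w 4) i * C j a (w 2) l * C k (w 1) (w 0) l := rfl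
    have h₂ : jacobiMixedTerm C i k j (w ∘ π) =
        ∑ a, ∑ l, C a (w 3) (w 4) i * C k a (w 2) l * C j (w 1) (w 0) l := rfl
    have h₃ : jacobiSqTerm C j k i (w ∘ Equiv.swap 3 4) =
        ∑ a, ∑ l, C l (w 0) (w 1) a * C l (w 2) j k * C i (w 4) (w 3) a := Finset.sum_comm
    rw [h₁, h₂, h₃]
    simp only [alt3, Finset.mul_sum, ← Finset.sum_add_distrib, ← Finset.sum_sub_distrib]
    refine Finset.sum_congr rfl fun a _ => Finset.sum_congr rfl fun l _ => ?_
    rw [hrev k (w 1), hrev j (w 1), hrev i (w 4), hanti a j, hanti a k,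
      show C l (w 2) j k = C k j (w 2) l from hrev _ _ _ _, hanti j k]
    ring
  simp only [hexpand, sym5_const_mul, sym5_add, sym5_sub, sym5_comp_perm] at hzero
  linarith

/-- If an algebraic curvature tensor on `ℝ^m` (`m ≥ 2`) satisfies the first TSN
condition (T1), then it satisfies the identity (T4):
`Sym_{(p,q,r,s,t)} Alt_{[i,j,k]} Σ_{ℓ,m}
( C_{ℓpqm} C_{ℓrij} C_{kstm} + 2 C_{ℓpqi} C_{jℓrm} C_{kstm} ) = 0`. -/
theorem T4_from_T1 {m : ℕ} (hm : 2 ≤ m)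
    (C : Fin m → Fin m → Fin m → Fin m → ℝ) (hC : IsACT C)
    (hT1 : T1 C) :
    ∀ p q r s t i j k : Fin m,
      sym5 (fun w =>
        alt3 (fun i' j' k' => ∑ l, ∑ a,
          (C l (w 0) (w 1) a * C l (w 2) i' j' * C k' (w 3) (w 4) a
            + 2 * C l (w 0) (w 1) i' * C j' l (w 2) a * C k' (w 3) (w 4) a)) i j k)
        ![p, q, r, s, t] = 0 := by
  intro p q r s t i j k
  have hsummand (w : Fin 5 → Fin m) (i j k : Fin m) : ∑ l, ∑ a,
      (C l (w 0) (w 1) a * C l (w 2) i j * C k (w 3) (w 4) a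
        + 2 * C l (w 0) (w 1) i * C j l (w 2) a * C k (w 3) (w 4) a)
      = jacobiSqTerm C i j k w + 2 * jacobiMixedTerm C i j k w := by
    simp only [jacobiSqTerm, jacobiMixedTerm, Finset.sum_add_distrib, Finset.mul_sum, mul_assoc]
  have h (i j k : Fin m) := sym5_contracted_T1 hC hT1 i j k ![p, q, r, s, t]
  simp only [hsummand, alt3, sym5_add, sym5_sub, sym5_const_mul]
  linarith [h i j k, h i k j, h j i k, h j k i, h k i j, h k j i]
end

section
/- Let m ≥ 2 and let C be an algebraic curvature tensor on ℝ^m satisfying condition (T6): Sym_{(p,q,r,s,t)} Alt_{[i,j,k]} Σ_{ℓ,m} C_{ℓpqi} C_{jℓrm} C_{kstm} = 0 for all free indices. Then C satisfies (T7): Sym_{(p,q,r,s,t,u,v)} Alt_{[i,j,k]} Σ_{ℓ,m,n} C_{ℓpqm} C_{nrsi} C_{jtnℓ} C_{kuvm} = 0, and also (T8): Sym_{(p,q,r,s,t,u,v)} Alt_{[i,j,k]} Σ_{ℓ,m,n} C_{ℓpqm} C_{nrsi} C_{jℓtn} C_{kuvm} = Sym_{(p,q,r,s,t,u,v)} Alt_{[i,j,k]}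 Σ_{ℓ,m,n} C_{ℓpqm} C_{nrsi} C_{jntℓ} C_{kuvm}, for all free indices p,q,r,s,t,u,v,i,j,k. -/
/-- Condition (T6): `Sym_{(p,q,r,s,t)} Alt_{[i,j,k]} Σ_{ℓ,m} C_{ℓpqi} C_{jℓrm} C_{kstm} = 0`. -/
def T6 {m : ℕ} (C : Fin m → Fin m → Fin m → Fin m → ℝ) : Prop :=
  ∀ p q r s t i j k : Fin m,
    sym5 (fun w =>
      alt3 (fun i' j' k' => ∑ l, ∑ a,
        C l (w 0) (w 1) i' * C j' l (w 2) a * C k' (w 3) (w 4) a) i j k)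
      ![p, q, r, s, t] = 0

section Symmetrization

variable {m : ℕ}

lemma sym7_add (F G : (Fin 7 → Fin m) → ℝ) (v : Fin 7 → Fin m) :
    sym7 (fun w => F w + G w) v = sym7 F v + sym7 G v :=
  Finset.sum_add_distrib

lemma sym7_sub (F G : (Fin 7 → Fin m) → ℝ) (v : Fin 7 → Fin m) :
    sym7 (fun w => F w - G w) v = sym7 F v - sym7 G v :=
  Finset.sum_sub_distrib _ _

lemma sym7_alt3 (F : Fin m → Fin m → Fin m → (Fin 7 → Fin m) → ℝ) (i j k : Fin m)
    (v : Fin 7 → Fin m) :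
    sym7 (fun w => alt3 (fun i' j' k' => F i' j' k' w) i j k) v =
      alt3 (fun i' j' k' => sym7 (F i' j' k') v) i j k := by
  simp only [alt3, sym7_add, sym7_sub]

/-- Symmetrizing does not see a prior permutation of the slots. -/
lemma sym7_comp_perm (τ : Equiv.Perm (Fin 7)) (F : (Fin 7 → Fin m) → ℝ) (v : Fin 7 → Fin m) :
    sym7 (fun w => F (w ∘ τ)) v = sym7 F v :=
  Fintype.sum_equiv (Equiv.mulRight τ) _ _ fun _ => rfl

/-- A function of seven indices whose symmetrization over the first five vanishes has vanishing
total symmetrization. -/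
lemma sym7_eq_zero_of_sym5 (G : Fin m → Fin m → (Fin 5 → Fin m) → ℝ)
    (hG : ∀ a b u, sym5 (G a b) u = 0) (v : Fin 7 → Fin m) :
    sym7 (fun w => G (w 5) (w 6) (w ∘ Fin.castLE (by decide))) v = 0 := by
  let ι : Fin 5 ↪ Fin 7 := (Fin.castLEEmb (by decide))
  set H : (Fin 7 → Fin m) → ℝ := fun w => G (w 5) (w 6) (w ∘ ι)
  have hfix : ∀ (π : Equiv.Perm (Fin 5)) (x : Fin 7), 5 ≤ x.val → π.viaEmbedding ι x = x := by
    intro π x hx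
    refine π.viaEmbedding_apply_of_notMem ι x ?_
    rintro ⟨y, rfl⟩
    have : (ι y).val = y.val := rfl
    omega
  have hperm : ∀ (π : Equiv.Perm (Fin 5)) (w : Fin 7 → Fin m),
      H (w ∘ π.viaEmbedding ι) = G (w 5) (w 6) ((w ∘ ι) ∘ π) := by
    intro π w
    have h5 := hfix π 5 (by decide)
    have h6 := hfix π 6 (by decide)
    have hι : (w ∘ π.viaEmbedding ι) ∘ ι = (w ∘ ι) ∘ π :=
      funext fun y => congrArg w (π.viaEmbedding_apply ι y)
    simp only [H, hι, Function.comp_apply, h5, h6]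
  have hsum : ∑ _π : Equiv.Perm (Fin 5), sym7 H v = 0 := by
    calc ∑ _π : Equiv.Perm (Fin 5), sym7 H v
        = ∑ π : Equiv.Perm (Fin 5), sym7 (fun w => H (w ∘ π.viaEmbedding ι)) v :=
          Finset.sum_congr rfl fun π _ => (sym7_comp_perm _ H v).symm
      _ = ∑ σ : Equiv.Perm (Fin 7), sym5 (G (v (σ 5)) (v (σ 6))) ((v ∘ σ) ∘ ι) := by
          simp only [hperm]
          exact Finset.sum_comm
      _ = 0 := Finset.sum_eq_zero fun σ _ => hG _ _ _
  rw [Finset.sum_const, Finset.card_univ, nsmul_eq_mul] at hsum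
  exact (mul_eq_zero.mp hsum).resolve_left (Nat.cast_ne_zero.mpr Fintype.card_ne_zero)

end Symmetrization

lemma sum_rotate {ι M : Type*} [Fintype ι] [AddCommMonoid M] (f : ι → ι → ι → M) :
    ∑ x, ∑ y, ∑ z, f x y z = ∑ x, ∑ y, ∑ z, f z x y :=
  Finset.sum_comm.trans (Finset.sum_congr rfl fun _ _ => Finset.sum_comm)

section Contractions

variable {m : ℕ} (C : Fin m → Fin m → Fin m → Fin m → ℝ)

/-- With `S_{ab} = C_{axxb}` the Jacobi operator, the polarization of `C(e_j, S²e_k, x, Se_i)`. -/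
noncomputable def leftChain (i j k : Fin m) (w : Fin 7 → Fin m) : ℝ :=
  ∑ l, ∑ a, ∑ n, C l (w 0) (w 1) a * C n (w 2) (w 3) i * C j l (w 4) n * C k (w 5) (w 6) a

/-- The polarization of `C(e_j, Se_i, x, S²e_k)`. -/
noncomputable def rightChain (i j k : Fin m) (w : Fin 7 → Fin m) : ℝ :=
  ∑ l, ∑ a, ∑ n, C l (w 0) (w 1) a * C n (w 2) (w 3) i * C j n (w 4) l * C k (w 5) (w 6) a

/-- The polarization of `C(e_j, x, Se_i, S²e_k)`. -/
noncomputable def middleChain (i j k : Fin m) (w : Fin 7 → Fin m) : ℝ :=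
  ∑ l, ∑ a, ∑ n, C l (w 0) (w 1) a * C n (w 2) (w 3) i * C j (w 4) n l * C k (w 5) (w 6) a

/-- The polarization of `C(Se_i, Se_j, x, Se_k)`. -/
noncomputable def cubicChain (i j k : Fin m) (w : Fin 7 → Fin m) : ℝ :=
  ∑ x, ∑ y, ∑ z, C x (w 0) (w 1) i * C y (w 2) (w 3) j * C x y (w 4) z * C z (w 5) (w 6) k

variable {C}

lemma IsACT.reverse (hC : IsACT C) (a b c d : Fin m) : C a b c d = C d c b a := by
  rw [hC.2.1 a b c d, hC.1 c d a b, hC.2.1 d c a b, hC.1 a b d c, hC.2.1 b a d c, neg_neg]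

lemma IsACT.swap_right_s10 (hC : IsACT C) (a b c d : Fin m) : C a b c d = -C a b d c := by
  rw [hC.2.1 a b c d, hC.1 c d a b, hC.2.1 d c a b]

lemma IsACT.leftChain_sub_rightChain (hC : IsACT C) (i j k : Fin m) (w : Fin 7 → Fin m) :
    leftChain C i j k w - rightChain C i j k w = -middleChain C i j k w := by
  simp only [leftChain, rightChain, middleChain, ← Finset.sum_sub_distrib, ← Finset.sum_neg_distrib]
  refine Finset.sum_congr rfl fun l _ => Finset.sum_congr rfl fun a _ =>
    Finset.sum_congr rfl fun n _ => ?_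
  have h := hC.2.2 j l (w 4) n
  have h' := hC.swap_right_s10 j n l (w 4)
  linear_combination C l (w 0) (w 1) a * C n (w 2) (w 3) i * C k (w 5) (w 6) a * (h - h')

lemma IsACT.sym7_cubicChain_cyclic (hC : IsACT C) (i j k : Fin m) (v : Fin 7 → Fin m) :
    sym7 (cubicChain C i j k) v + sym7 (cubicChain C j k i) v + sym7 (cubicChain C k i j) v = 0 := by
  let τ : Equiv.Perm (Fin 7) :=
    ⟨![2, 3, 5, 6, 4, 0, 1], ![5, 6, 0, 1, 4, 2, 3], by decide, by decide⟩
  have hτ : ∀ w : Fin 7 → Fin m, cubicChain C i j k w + cubicChain C j k i (w ∘ τ) +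
      cubicChain C k i j ((w ∘ τ) ∘ τ) = 0 := by
    intro w
    have h₁ : cubicChain C j k i (w ∘ τ) = ∑ x, ∑ y, ∑ z,
        C y (w 2) (w 3) j * C z (w 5) (w 6) k * C y z (w 4) x * C x (w 0) (w 1) i :=
      (sum_rotate _).trans (sum_rotate _)
    have h₂ : cubicChain C k i j ((w ∘ τ) ∘ τ) = ∑ x, ∑ y, ∑ z,
        C z (w 5) (w 6) k * C x (w 0) (w 1) i * C z x (w 4) y * C y (w 2) (w 3) j :=
      sum_rotate _
    rw [h₁, h₂, cubicChain]
    simp only [← Finset.sum_add_distrib]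
    refine Finset.sum_eq_zero fun x _ => Finset.sum_eq_zero fun y _ =>
      Finset.sum_eq_zero fun z _ => ?_
    have h := hC.2.2 (w 4) z x y
    rw [hC.2.1 (w 4) z x y, hC.2.1 (w 4) x y z, hC.2.1 (w 4) y z x] at h
    linear_combination C x (w 0) (w 1) i * C y (w 2) (w 3) j * C z (w 5) (w 6) k *
      h
  rw [← sym7_comp_perm τ (cubicChain C j k i), ← sym7_comp_perm τ (cubicChain C k i j),
    ← sym7_comp_perm τ (fun w => cubicChain C k i j (w ∘ τ)), ← sym7_add, ← sym7_add]
  simp only [hτ, sym7, Finset.sum_const_zero]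

/-- Contracting (T6) with one more Jacobi operator. -/
lemma IsACT.sym7_contract_T6 (hC : IsACT C) (hT6 : T6 C) (i j k : Fin m) (v : Fin 7 → Fin m) :
    sym7 (leftChain C k j i) v - sym7 (leftChain C j k i) v - sym7 (cubicChain C i j k) v
      + sym7 (rightChain C j k i) v + sym7 (cubicChain C i k j) v
      - sym7 (rightChain C k j i) v = 0 := by
  let E : (Fin 5 → Fin m) → Fin m → Fin m → Fin m → ℝ := fun u i' j' k' =>
    ∑ l, ∑ a, C l (u 0) (u 1) i' * C j' l (u 2) a * C k' (u 3) (u 4) a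
  have hE : ∀ u b, sym5 (fun u => alt3 (E u) b j k) u = 0 := by
    intro u b
    have hu : u = ![u 0, u 1, u 2, u 3, u 4] := by
      funext x
      fin_cases x <;> rfl
    rw [hu]
    exact hT6 _ _ _ _ _ b j k
  have hzero := sym7_eq_zero_of_sym5 (fun p q u => ∑ b, C i p q b * alt3 (E u) b j k)
    (fun p q u => by
      unfold sym5
      rw [Finset.sum_comm]
      refine Finset.sum_eq_zero fun b _ => ?_
      rw [← Finset.mul_sum]
      exact mul_eq_zero_of_right _ (hE u b)) v
  let τL : Equiv.Perm (Fin 7) :=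
    ⟨![0, 1, 4, 3, 2, 5, 6], ![0, 1, 4, 3, 2, 5, 6], by decide, by decide⟩
  let τR : Equiv.Perm (Fin 7) :=
    ⟨![4, 3, 0, 1, 2, 5, 6], ![2, 3, 4, 1, 0, 5, 6], by decide, by decide⟩
  let τD : Equiv.Perm (Fin 7) :=
    ⟨![6, 5, 0, 1, 2, 4, 3], ![2, 3, 4, 6, 5, 1, 0], by decide, by decide⟩
  let ι : Fin 5 → Fin 7 := Fin.castLE (by decide)
  have hL : ∀ (w : Fin 7 → Fin m) (a b : Fin m),
      ∑ c, C i (w 5) (w 6) c * E (w ∘ ι) c a b = leftChain C b a i (w ∘ τL) := by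
    intro w a b
    simp only [E, leftChain, Finset.mul_sum]
    rw [Finset.sum_comm]
    refine Finset.sum_congr rfl fun x _ => Finset.sum_congr rfl fun y _ =>
      Finset.sum_congr rfl fun z _ => ?_
    change C i (w 5) (w 6) y * (C x (w 0) (w 1) y * C a x (w 2) z * C b (w 3) (w 4) z) =
      C x (w 0) (w 1) y * C z (w 4) (w 3) b * C a x (w 2) z * C i (w 5) (w 6) y
    rw [hC.reverse b]
    ring
  have hR : ∀ (w : Fin 7 → Fin m) (a b : Fin m),
      ∑ c, C i (w 5) (w 6) c * E (w ∘ ι) a b c = rightChain C a b i (w ∘ τR) := by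
    intro w a b
    simp only [E, rightChain, Finset.mul_sum]
    rw [sum_rotate, sum_rotate]
    refine Finset.sum_congr rfl fun x _ => Finset.sum_congr rfl fun y _ =>
      Finset.sum_congr rfl fun z _ => ?_
    change C i (w 5) (w 6) y * (C z (w 0) (w 1) a * C b z (w 2) x * C y (w 3) (w 4) x) =
      C x (w 4) (w 3) y * C z (w 0) (w 1) a * C b z (w 2) x * C i (w 5) (w 6) y
    rw [hC.reverse y]
    ring
  have hD : ∀ (w : Fin 7 → Fin m) (a b : Fin m),
      ∑ c, C i (w 5) (w 6) c * E (w ∘ ι) a c b = cubicChain C i a b (w ∘ τD) := by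
    intro w a b
    simp only [E, cubicChain, Finset.mul_sum]
    refine Finset.sum_congr rfl fun x _ => Finset.sum_congr rfl fun y _ =>
      Finset.sum_congr rfl fun z _ => ?_
    change C i (w 5) (w 6) x * (C y (w 0) (w 1) a * C x y (w 2) z * C b (w 3) (w 4) z) =
      C x (w 6) (w 5) i * C y (w 0) (w 1) a * C x y (w 2) z * C z (w 4) (w 3) b
    rw [hC.reverse i, hC.reverse b]
    ring
  rw [← sym7_comp_perm τL (leftChain C k j i), ← sym7_comp_perm τL (leftChain C j k i),
    ← sym7_comp_perm τR (rightChain C k j i), ← sym7_comp_perm τR (rightChain C j k i),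
    ← sym7_comp_perm τD (cubicChain C i j k), ← sym7_comp_perm τD (cubicChain C i k j),
    ← hzero, ← sym7_sub, ← sym7_sub, ← sym7_add, ← sym7_add, ← sym7_sub]
  congr 1
  funext w
  simp only [← hL, ← hR, ← hD, ← Finset.sum_sub_distrib, ← Finset.sum_add_distrib, alt3]
  refine Finset.sum_congr rfl fun b _ => ?_
  simp only [ι]
  ring

lemma IsACT.alt3_sym7_middleChain (hC : IsACT C) (hT6 : T6 C) (i j k : Fin m)
    (v : Fin 7 → Fin m) :
    alt3 (fun i' j' k' => sym7 (middleChain C i' j' k') v) i j k = 0 := by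
  have hmid : ∀ a b c, sym7 (middleChain C a b c) v =
      sym7 (rightChain C a b c) v - sym7 (leftChain C a b c) v := by
    intro a b c
    rw [← sym7_sub]
    congr 1
    funext w
    linarith [hC.leftChain_sub_rightChain a b c w]
  simp only [alt3, hmid]
  linarith [hC.sym7_contract_T6 hT6 i j k v, hC.sym7_contract_T6 hT6 j k i v,
    hC.sym7_contract_T6 hT6 k i j v, hC.sym7_cubicChain_cyclic i j k v,
    hC.sym7_cubicChain_cyclic i k j v]

end Contractions

/-- If an algebraic curvature tensor on `ℝ^m` (`m ≥ 2`) satisfies (T6), then it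
satisfies (T7): `Sym_{(p,q,r,s,t,u,v)} Alt_{[i,j,k]} Σ_{ℓ,m,n}
C_{ℓpqm} C_{nrsi} C_{jtnℓ} C_{kuvm} = 0`, and (T8):
`Sym Alt Σ C_{ℓpqm} C_{nrsi} C_{jℓtn} C_{kuvm} = Sym Alt Σ C_{ℓpqm} C_{nrsi} C_{jntℓ} C_{kuvm}`. -/
theorem T7_and_T8_from_T6 {m : ℕ} (hm : 2 ≤ m)
    (C : Fin m → Fin m → Fin m → Fin m → ℝ) (hC : IsACT C)
    (hT6 : T6 C) :
    (∀ p q r s t u v i j k : Fin m,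
      sym7 (fun w =>
        alt3 (fun i' j' k' => ∑ l, ∑ a, ∑ n,
          C l (w 0) (w 1) a * C n (w 2) (w 3) i' * C j' (w 4) n l * C k' (w 5) (w 6) a)
          i j k)
        ![p, q, r, s, t, u, v] = 0) ∧
    (∀ p q r s t u v i j k : Fin m,
      sym7 (fun w =>
        alt3 (fun i' j' k' => ∑ l, ∑ a, ∑ n,
          C l (w 0) (w 1) a * C n (w 2) (w 3) i' * C j' l (w 4) n * C k' (w 5) (w 6) a)
          i j k)
        ![p, q, r, s, t, u, v]
      = sym7 (fun w =>
          alt3 (fun i' j' k' => ∑ l, ∑ a, ∑ n,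
            C l (w 0) (w 1) a * C n (w 2) (w 3) i' * C j' n (w 4) l * C k' (w 5) (w 6) a)
            i j k)
          ![p, q, r, s, t, u, v]) := by
  have h7 : ∀ p q r s t u v i j k : Fin m,
      sym7 (fun w => alt3 (fun i' j' k' => middleChain C i' j' k' w) i j k)
        ![p, q, r, s, t, u, v] = 0 := fun p q r s t u v i j k => by
    rw [sym7_alt3, hC.alt3_sym7_middleChain hT6]
  refine ⟨h7, fun p q r s t u v i j k => ?_⟩
  have h := h7 p q r s t u v i j k
  change sym7 (fun w => alt3 (fun i' j' k' => leftChain C i' j' k' w) i j k) _ =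
    sym7 (fun w => alt3 (fun i' j' k' => rightChain C i' j' k' w) i j k) _
  rw [← sub_eq_zero, ← sym7_sub, ← neg_eq_zero, ← h]
  simp only [sym7, ← Finset.sum_neg_distrib]
  refine Finset.sum_congr rfl fun σ _ => ?_
  have hd := fun a b c => hC.leftChain_sub_rightChain a b c (![p, q, r, s, t, u, v] ∘ σ)
  simp only [alt3]
  linarith [hd i j k, hd i k j, hd j i k, hd j k i, hd k i j, hd k j i]
end

section
/- Let m ≥ 2 and let C be an algebraic curvature tensor on ℝ^m satisfying condition (T1): Sym_{(p,q,r)} Alt_{[i,j,k]} Σ_ℓ C_{ℓpqi} C_{jkrℓ} = 0 and condition (T2): Sym_{(p,q,r,s,t)} Alt_{[i,j,k]} Σ_{ℓ,m} ( C_{ℓpqm} C_{ℓrij} C_{kstm} − 2 C_{ℓpqi} C_{jℓrm} C_{kstm} ) = 0 for all free indices. Set K^i_j(x) = 4 Σ_{k,l} C_{ikjl} x_k x_l and let N^i_{jk}(x) = Σ_ℓ [ K^i_ℓ (∂_k K^ℓ_j − ∂_j K^ℓ_k) + K^ℓ_j ∂_ℓ K^i_k − K^ℓ_k ∂_ℓ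 K^i_j ] be its Nijenhuis tensor. Then the Haantjes tensor of K, H^i_{jk} = Σ_{ℓ,m} [ K^i_m K^m_ℓ N^ℓ_{jk} + N^i_{ℓm} K^ℓ_j K^m_k − K^i_ℓ N^ℓ_{jm} K^m_k − K^i_ℓ N^ℓ_{mk} K^m_j ], vanishes identically: H^i_{jk}(x) = 0 for all x ∈ ℝ^m and all i,j,k. -/
namespace HaantjesTSN

variable {m : ℕ}

/-- The quadratic form `C i x j x`. -/
noncomputable def jac (C : Fin m → Fin m → Fin m → Fin m → ℝ) (x : Fin m → ℝ)
    (i j : Fin m) : ℝ :=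
  ∑ k, ∑ l, C i k j l * x k * x l

/-- The contraction `C i j k x`. -/
noncomputable def con1 (C : Fin m → Fin m → Fin m → Fin m → ℝ) (x : Fin m → ℝ)
    (i j k : Fin m) : ℝ :=
  ∑ l, C i j k l * x l

/-- Evaluation of a three-tensor on three vectors. -/
noncomputable def ev (T : Fin m → Fin m → Fin m → ℝ) (u v w : Fin m → ℝ) : ℝ :=
  ∑ i, ∑ j, ∑ k, T i j k * (u i * v j * w k)

section ev

variable (S T : Fin m → Fin m → Fin m → ℝ) (u v w : Fin m → ℝ)

lemma ev_add : ev (fun i j k => S i j k + T i j k) u v w = ev S u v w + ev T u v w := by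
  simp only [ev, add_mul, Finset.sum_add_distrib]

lemma ev_sub : ev (fun i j k => S i j k - T i j k) u v w = ev S u v w - ev T u v w := by
  simp only [ev, sub_mul, Finset.sum_sub_distrib]

lemma ev_smul (c : ℝ) : ev (fun i j k => c * T i j k) u v w = c * ev T u v w := by
  simp only [ev, mul_assoc, Finset.mul_sum]

lemma ev_swap_left : ev (fun i j k => T j i k) u v w = ev T v u w := by
  unfold ev
  rw [Finset.sum_comm]
  simp only [mul_comm (u _) (v _)]

lemma ev_swap_right : ev (fun i j k => T i k j) u v w = ev T u w v := by
  unfold ev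
  refine Finset.sum_congr rfl fun i _ => ?_
  rw [Finset.sum_comm]
  simp only [mul_right_comm (u _) (v _)]

lemma ev_rotate : ev (fun i j k => T j k i) u v w = ev T v w u := by
  rw [ev_swap_left (fun i j k => T i k j), ev_swap_right]

lemma ev_rotate' : ev (fun i j k => T k i j) u v w = ev T w u v := by
  rw [ev_swap_right (fun i j k => T j i k), ev_swap_left]

lemma ev_swap_outer : ev (fun i j k => T k j i) u v w = ev T w v u := by
  rw [ev_swap_left (fun i j k => T k i j), ev_rotate']

lemma ev_alt3 : ev (fun i j k => alt3 T i j k) u v w =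
    ev T u v w - ev T u w v - ev T v u w + ev T v w u + ev T w u v - ev T w v u := by
  simp only [alt3, ev_add, ev_sub]
  rw [ev_swap_left T, ev_swap_right T, ev_rotate T,
    ev_rotate' T, ev_swap_outer T]

variable {κ : Fin m → Fin m → ℝ} {u v w : Fin m → ℝ} {α β γ : ℝ}

lemma ev_apply_fst (hu : ∀ l, ∑ i, κ i l * u i = α * u l) :
    ev (fun i j k => ∑ l, κ i l * T l j k) u v w = α * ev T u v w := by
  have h (i : Fin m) : ∑ j, ∑ k, (∑ l, κ i l * T l j k) * (u i * v j * w k) =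
      ∑ l, κ i l * u i * ∑ j, ∑ k, T l j k * (v j * w k) := by
    simp only [Finset.mul_sum, Finset.sum_mul]
    rw [Finset.sum_comm (γ := Fin m) (s := Finset.univ (α := Fin m))
      (f := fun l j => ∑ k, κ i l * u i * (T l j k * (v j * w k)))]
    refine Finset.sum_congr rfl fun j _ => ?_
    rw [Finset.sum_comm]
    refine Finset.sum_congr rfl fun l _ => Finset.sum_congr rfl fun k _ => by ring
  unfold ev
  simp only [h]
  rw [Finset.sum_comm]
  simp only [← Finset.sum_mul, hu]
  simp only [Finset.mul_sum]
  refine Finset.sum_congr rfl fun i _ => Finset.sum_congr rfl fun j _ =>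
    Finset.sum_congr rfl fun k _ => by ring

lemma ev_apply_snd (hv : ∀ l, ∑ i, κ i l * v i = β * v l) :
    ev (fun i j k => ∑ l, κ j l * T i l k) u v w = β * ev T u v w := by
  rw [ev_swap_left (fun j i k => ∑ l, κ j l * T i l k),
    ev_apply_fst (fun l i k => T i l k) hv, ev_swap_left]

lemma ev_apply_trd (hw : ∀ l, ∑ i, κ i l * w i = γ * w l) :
    ev (fun i j k => ∑ l, κ k l * T i j l) u v w = γ * ev T u v w := by
  rw [ev_swap_right (fun i k j => ∑ l, κ k l * T i j l),
    ev_apply_snd (fun i l j => T i j l) hw, ev_swap_right]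

end ev

lemma pd_Kf (C : Fin m → Fin m → Fin m → Fin m → ℝ) (hC : IsACT C) (x : Fin m → ℝ)
    (i j k : Fin m) :
    pd (fun y => Kf C y i j) k x = 4 * (con1 C x i k j + con1 C x j k i) := by
  have h : HasFDerivAt (fun y : Fin m → ℝ => Kf C y i j)
      ((4 : ℝ) • ∑ p, ∑ q, ((C i p j q * x p) • (ContinuousLinearMap.proj q : (Fin m → ℝ) →L[ℝ] ℝ)
        + x q • (C i p j q • (ContinuousLinearMap.proj p : (Fin m → ℝ) →L[ℝ] ℝ)))) x := by
    unfold Kf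
    refine HasFDerivAt.const_mul ?_ 4
    refine HasFDerivAt.fun_sum fun p _ => HasFDerivAt.fun_sum fun q _ => ?_
    exact ((hasFDerivAt_apply p x).const_mul (C i p j q)).mul (hasFDerivAt_apply q x)
  unfold pd
  rw [h.fderiv]
  simp only [smul_apply, sum_apply,
    add_apply, ContinuousLinearMap.proj_apply, smul_eq_mul, con1,
    Finset.sum_add_distrib, Pi.single_apply, mul_ite, mul_one, mul_zero, Finset.sum_ite_eq',
    Finset.sum_ite_irrel, Finset.sum_const_zero, Finset.mem_univ, if_true]
  rw [add_comm]
  congr 2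
  · exact Finset.sum_congr rfl fun l _ => by ring
  · exact Finset.sum_congr rfl fun l _ => by rw [hC.2.1]

lemma jac_symm {C : Fin m → Fin m → Fin m → Fin m → ℝ} (hC : IsACT C) (x : Fin m → ℝ)
    (i j : Fin m) : jac C x i j = jac C x j i := by
  unfold jac
  rw [Finset.sum_comm]
  refine Finset.sum_congr rfl fun k _ => Finset.sum_congr rfl fun l _ => ?_
  rw [hC.2.1]; ring

lemma con1_antisymm {C : Fin m → Fin m → Fin m → Fin m → ℝ} (hC : IsACT C) (x : Fin m → ℝ)
    (i j k : Fin m) : con1 C x j i k = (-1) * con1 C x i j k := by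
  unfold con1
  rw [Finset.mul_sum]
  exact Finset.sum_congr rfl fun l _ => by rw [hC.1]; ring

lemma con1_cyclic {C : Fin m → Fin m → Fin m → Fin m → ℝ} (hC : IsACT C) (x : Fin m → ℝ)
    (i j k : Fin m) : con1 C x i j k + con1 C x j k i + con1 C x k i j = 0 := by
  unfold con1
  rw [← Finset.sum_add_distrib, ← Finset.sum_add_distrib]
  refine Finset.sum_eq_zero fun l _ => ?_
  have h := hC.2.2 l i j k
  have h1 : C i j k l = - C l k i j := by rw [hC.2.1 i j k l, hC.1 k l]
  have h2 : C j k i l = - C l i j k := by rw [hC.2.1 j k i l, hC.1 i l]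
  have h3 : C k i j l = - C l j k i := by rw [hC.2.1 k i j l, hC.1 j l]
  rw [h1, h2, h3]
  linear_combination (-x l) * h

lemma sum_fin_succ_fun {n : ℕ} (f : (Fin (n + 1) → Fin m) → ℝ) :
    ∑ w, f w = ∑ a, ∑ w : Fin n → Fin m, f (Fin.cons a w) := by
  rw [← (Fin.consEquiv fun _ : Fin (n + 1) => Fin m).sum_comp, Fintype.sum_prod_type]
  rfl

lemma sum_mul_sym5 (F : (Fin 5 → Fin m) → ℝ) (x : Fin m → ℝ) :
    ∑ w : Fin 5 → Fin m, (∏ n, x (w n)) * sym5 F w =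
      120 * ∑ w : Fin 5 → Fin m, (∏ n, x (w n)) * F w := by
  unfold sym5
  simp only [Finset.mul_sum]
  rw [Finset.sum_comm]
  have h (σ : Equiv.Perm (Fin 5)) : ∑ w : Fin 5 → Fin m, (∏ n, x (w n)) * F (w ∘ σ) =
      ∑ w : Fin 5 → Fin m, (∏ n, x (w n)) * F w := by
    rw [← (Equiv.arrowCongr σ.symm (Equiv.refl (Fin m))).sum_comp
      fun w => (∏ n, x (w n)) * F w]
    refine Finset.sum_congr rfl fun w _ => ?_
    congr 1
    exact (Equiv.prod_comp σ fun n => x (w n)).symm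
  simp only [h, Finset.sum_const, Finset.card_univ, Fintype.card_perm, Fintype.card_fin,
    Nat.factorial, nsmul_eq_mul, ← Finset.mul_sum]
  norm_num

lemma sum_mul_sym3 (F : Fin m → Fin m → Fin m → ℝ) (x : Fin m → ℝ) :
    ev (fun p q r => sym3 F p q r) x x x = 6 * ev F x x x := by
  simp only [sym3, ev_add]
  rw [ev_swap_left F, ev_swap_right F, ev_rotate F,
    ev_rotate' F, ev_swap_outer F]
  ring

lemma sum_sum_mul_mul (x : Fin m → ℝ) (P R : Fin m → Fin m → ℝ) (Q : Fin m → ℝ) :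
    ∑ w : Fin 5 → Fin m, (∏ n, x (w n)) * (P (w 0) (w 1) * Q (w 2) * R (w 3) (w 4)) =
      (∑ p, ∑ q, P p q * x p * x q) * (∑ s, ∑ t, R s t * x s * x t) * ∑ r, Q r * x r := by
  simp only [sum_fin_succ_fun, Fintype.sum_unique, Fin.prod_univ_five, Finset.sum_mul]
  refine Finset.sum_congr rfl fun p _ => Finset.sum_congr rfl fun q _ => ?_
  simp only [Finset.mul_sum, Finset.sum_mul]
  refine Finset.sum_congr rfl fun r _ => Finset.sum_congr rfl fun s _ =>
    Finset.sum_congr rfl fun t _ => ?_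
  change (x p * x q * x r * x s * x t) * (P p q * Q r * R s t) = _
  ring

lemma ev_sum (T : Fin m → Fin m → Fin m → Fin m → ℝ) (u v w : Fin m → ℝ) :
    ev (fun i j k => ∑ l, T l i j k) u v w = ∑ l, ev (T l) u v w := by
  simp only [ev, Finset.sum_mul]
  conv_rhs => rw [Finset.sum_comm]
  refine Finset.sum_congr rfl fun i _ => ?_
  conv_rhs => rw [Finset.sum_comm]
  refine Finset.sum_congr rfl fun j _ => Finset.sum_comm

lemma ev_mul (P : Fin m → Fin m → ℝ) (Q : Fin m → ℝ) (x : Fin m → ℝ) :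
    ev (fun p q r => P p q * Q r) x x x =
      (∑ p, ∑ q, P p q * x p * x q) * ∑ r, Q r * x r := by
  simp only [ev, Finset.sum_mul]
  simp only [Finset.mul_sum]
  refine Finset.sum_congr rfl fun p _ => Finset.sum_congr rfl fun q _ =>
    Finset.sum_congr rfl fun r _ => by ring

lemma sum_mul_alt3 {ι : Type*} [Fintype ι] (c : ι → ℝ) (S : ι → Fin m → Fin m → Fin m → ℝ)
    (i j k : Fin m) :
    ∑ w, c w * alt3 (S w) i j k = alt3 (fun i j k => ∑ w, c w * S w i j k) i j k := by
  simp only [alt3, mul_add, mul_sub, Finset.sum_add_distrib, Finset.sum_sub_distrib]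

section contraction

variable {C : Fin m → Fin m → Fin m → Fin m → ℝ}

lemma curvature_swap_right (hC : IsACT C) (i j k l : Fin m) : C i j k l = - C i j l k := by
  rw [hC.2.1, hC.1, hC.2.1]

lemma sum_inner_eq_neg_jac (hC : IsACT C) (x : Fin m → ℝ) (i j : Fin m) :
    ∑ p, ∑ q, C i p q j * x p * x q = - jac C x i j := by
  simp only [jac, ← Finset.sum_neg_distrib]
  refine Finset.sum_congr rfl fun p _ => Finset.sum_congr rfl fun q _ => ?_
  rw [curvature_swap_right hC]; ring

lemma sum_third_eq_neg_con1 (hC : IsACT C) (x : Fin m → ℝ) (i j k : Fin m) :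
    ∑ r, C i j r k * x r = - con1 C x i j k := by
  simp only [con1, ← Finset.sum_neg_distrib]
  refine Finset.sum_congr rfl fun r _ => ?_
  rw [curvature_swap_right hC]; ring

lemma sum_second_eq_con1 (hC : IsACT C) (x : Fin m → ℝ) (i j k : Fin m) :
    ∑ r, C k r i j * x r = con1 C x i j k := by
  simp only [con1]
  refine Finset.sum_congr rfl fun r _ => ?_
  rw [hC.2.1]

lemma contract_T1 (hC : IsACT C) (hT : T1 C) (x : Fin m → ℝ) (i j k : Fin m) :
    alt3 (fun i j k => ∑ l, jac C x i l * con1 C x j k l) i j k = 0 := by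
  have key (i j k : Fin m) : ev (fun p q r => ∑ l, C l p q i * C j k r l) x x x =
      ∑ l, jac C x i l * con1 C x j k l := by
    rw [ev_sum]
    refine Finset.sum_congr rfl fun l _ => ?_
    rw [ev_mul, sum_inner_eq_neg_jac hC, sum_third_eq_neg_con1 hC, jac_symm hC, neg_mul_neg]
  have h := sum_mul_sym3 (fun p q r =>
    alt3 (fun i j k => ∑ l, C l p q i * C j k r l) i j k) x
  have hz (p q r : Fin m) := hT p q r i j k
  simp only [hz] at h
  simp only [alt3, ev_add, ev_sub, key] at h ⊢
  have h0 : ev (fun _ _ _ : Fin m => (0 : ℝ)) x x x = 0 := by simp [ev]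
  linarith

lemma contract_T2 (hC : IsACT C) (hT : T2 C) (x : Fin m → ℝ) (i j k : Fin m) :
    alt3 (fun i j k => ∑ a, jac C x k a * (∑ l, jac C x a l * con1 C x i j l) +
      2 * ∑ l, jac C x i l * ∑ a, jac C x k a * con1 C x j l a) i j k = 0 := by
  have key (i j k : Fin m) : ∑ w : Fin 5 → Fin m, (∏ n, x (w n)) * (∑ l, ∑ a,
        (C l (w 0) (w 1) a * C l (w 2) i j * C k (w 3) (w 4) a
          - 2 * C l (w 0) (w 1) i * C j l (w 2) a * C k (w 3) (w 4) a)) =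
      ∑ a, jac C x k a * (∑ l, jac C x a l * con1 C x i j l) +
      2 * ∑ l, jac C x i l * ∑ a, jac C x k a * con1 C x j l a := by
    have h1 (l a : Fin m) := sum_sum_mul_mul x (fun p q => C l p q a) (fun p q => C k p q a)
      fun r => C l r i j
    have h2 (l a : Fin m) := sum_sum_mul_mul x (fun p q => C l p q i) (fun p q => C k p q a)
      fun r => C j l r a
    simp only [sum_inner_eq_neg_jac hC, sum_third_eq_neg_con1 hC, sum_second_eq_con1 hC] at h1 h2
    simp only [Finset.mul_sum]
    rw [Finset.sum_comm]
    simp only [Finset.sum_comm (s := (Finset.univ : Finset (Fin 5 → Fin m)))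
      (t := (Finset.univ : Finset (Fin m)))]
    have h3 (l a : Fin m) : ∑ w : Fin 5 → Fin m, (∏ n, x (w n)) *
        (C l (w 0) (w 1) a * C l (w 2) i j * C k (w 3) (w 4) a
          - 2 * C l (w 0) (w 1) i * C j l (w 2) a * C k (w 3) (w 4) a) =
        jac C x k a * (jac C x a l * con1 C x i j l) +
          2 * (jac C x i l * (jac C x k a * con1 C x j l a)) := by
      simp only [mul_sub, Finset.sum_sub_distrib, mul_assoc (2 : ℝ), mul_left_comm _ (2 : ℝ),
        ← Finset.mul_sum]
      rw [h1, h2, jac_symm hC x l a, jac_symm hC x l i]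
      ring
    simp only [h3, Finset.sum_add_distrib]
    congr 1
    exact Finset.sum_comm
  have h := sum_mul_sym5 (fun w =>
      alt3 (fun i j k => ∑ l, ∑ a,
        (C l (w 0) (w 1) a * C l (w 2) i j * C k (w 3) (w 4) a
          - 2 * C l (w 0) (w 1) i * C j l (w 2) a * C k (w 3) (w 4) a)) i j k) x
  have hv (w : Fin 5 → Fin m) : ![w 0, w 1, w 2, w 3, w 4] = w := by
    ext n; fin_cases n <;> rfl
  have hz (w : Fin 5 → Fin m) := hT (w 0) (w 1) (w 2) (w 3) (w 4) i j k
  simp only [hv] at hz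
  simp only [hz, mul_zero, Finset.sum_const_zero] at h
  rw [sum_mul_alt3] at h
  simp only [key] at h
  linarith

end contraction

lemma eq_zero_of_system {α β γ p q r : ℝ} (h0 : p + q + r = 0)
    (h1 : γ * p + α * q + β * r = 0)
    (h2 : γ ^ 2 * p + α ^ 2 * q + β ^ 2 * r
      - γ * (α + β) * p - β * (α + γ) * r - α * (β + γ) * q = 0) :
    (α - β) * (α - γ) * (α * (2 * q - p - r) + β * (p - q) - γ * (q - r)) = 0 := by
  have hr : r = - p - q := by linarith
  subst hr
  linear_combination (2 * α - β - γ) * h2 +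
    ((2 * α - β - γ) * (α - β - γ) - (α - β) * (α - γ)) * h1


section eigenvectors

variable {C : Fin m → Fin m → Fin m → Fin m → ℝ} {x u v w : Fin m → ℝ} {α β γ : ℝ}

lemma Nij_eq (hC : IsACT C) (x : Fin m → ℝ) (i j k : Fin m) :
    Nij C x i j k = 16 * (∑ l, jac C x i l *
        (con1 C x l k j + con1 C x j k l - con1 C x l j k - con1 C x k j l)
      + ∑ l, jac C x j l * (con1 C x i l k + con1 C x k l i)
      - ∑ l, jac C x k l * (con1 C x i l j + con1 C x j l i)) := by
  rw [← Finset.sum_add_distrib, ← Finset.sum_sub_distrib, Finset.mul_sum]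
  refine Finset.sum_congr rfl fun l _ => ?_
  rw [pd_Kf C hC, pd_Kf C hC, pd_Kf C hC, pd_Kf C hC, jac_symm hC x j l, jac_symm hC x k l]
  change (4 * jac C x i l) * _ + (4 * jac C x l j) * _ - (4 * jac C x l k) * _ = _
  ring

lemma ev_con1_swap (hC : IsACT C) (x u v w : Fin m → ℝ) :
    ev (con1 C x) v u w = - ev (con1 C x) u v w := by
  have h : (fun i j k => con1 C x j i k) = fun i j k => (-1) * con1 C x i j k := by
    funext i j k
    exact con1_antisymm hC x i j k
  rw [← ev_swap_left, h, ev_smul, neg_one_mul]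

lemma ev_con1_cyclic (hC : IsACT C) (x u v w : Fin m → ℝ) :
    ev (con1 C x) u v w + ev (con1 C x) v w u + ev (con1 C x) w u v = 0 := by
  rw [← ev_rotate (con1 C x) u v w, ← ev_rotate' (con1 C x) u v w, ← ev_add, ← ev_add]
  simp only [con1_cyclic hC]
  simp [ev]

lemma ev_alt3_eq_zero {T : Fin m → Fin m → Fin m → ℝ} (h : ∀ i j k, alt3 T i j k = 0)
    (u v w : Fin m → ℝ) :
    ev T u v w - ev T u w v - ev T v u w + ev T v w u + ev T w u v - ev T w v u = 0 := by
  rw [← ev_alt3]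
  simp only [h]
  simp [ev]

/-- On eigenvectors of the Jacobi form, the Nijenhuis tensor is given by `con1`. -/
lemma ev_Nij (hC : IsACT C) (hu : ∀ l, ∑ i, jac C x i l * u i = α * u l)
    (hv : ∀ l, ∑ i, jac C x i l * v i = β * v l) (hw : ∀ l, ∑ i, jac C x i l * w i = γ * w l) :
    ev (Nij C x) u v w =
      16 * (α * (2 * ev (con1 C x) v w u - ev (con1 C x) u v w - ev (con1 C x) w u v)
        + β * (ev (con1 C x) u v w - ev (con1 C x) v w u)
        - γ * (ev (con1 C x) v w u - ev (con1 C x) w u v)) := by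
  have h := funext fun i => funext fun j => funext fun k => Nij_eq hC x i j k
  change ev (fun i j k => Nij C x i j k) u v w = _
  rw [h, ev_smul, ev_sub, ev_add,
    ev_apply_fst (fun l j k => con1 C x l k j + con1 C x j k l - con1 C x l j k - con1 C x k j l) hu,
    ev_apply_snd (fun i l k => con1 C x i l k + con1 C x k l i) hv,
    ev_apply_trd (fun i j l => con1 C x i l j + con1 C x j l i) hw]
  simp only [ev_sub, ev_add]
  rw [ev_swap_right (con1 C x), ev_rotate (con1 C x), ev_swap_outer (con1 C x),
    ev_con1_swap hC x w u v, ev_con1_swap hC x v w u]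
  ring

lemma haantjes_eigen (hC : IsACT C) (hT1 : T1 C) (hT2 : T2 C)
    (hu : ∀ l, ∑ i, jac C x i l * u i = α * u l)
    (hv : ∀ l, ∑ i, jac C x i l * v i = β * v l) (hw : ∀ l, ∑ i, jac C x i l * w i = γ * w l) :
    (α - β) * (α - γ) * ev (Nij C x) u v w = 0 := by
  have e1 {a b c : Fin m → ℝ} {r : ℝ} (ha : ∀ l, ∑ i, jac C x i l * a i = r * a l) :
      ev (fun i j k => ∑ l, jac C x i l * con1 C x j k l) a b c = r * ev (con1 C x) b c a := by
    rw [ev_apply_fst (fun l j k => con1 C x j k l) ha, ev_rotate]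
  have e2 {a b c : Fin m → ℝ} {r s : ℝ} (ha : ∀ l, ∑ i, jac C x i l * a i = r * a l)
      (hc : ∀ l, ∑ i, jac C x i l * c i = s * c l) :
      ev (fun i j k => ∑ a, jac C x k a * (∑ l, jac C x a l * con1 C x i j l) +
        2 * ∑ l, jac C x i l * ∑ a, jac C x k a * con1 C x j l a) a b c =
      s ^ 2 * ev (con1 C x) a b c + 2 * (r * (s * ev (con1 C x) b a c)) := by
    rw [ev_add, ev_smul, ev_apply_trd (fun i j a => ∑ l, jac C x a l * con1 C x i j l) hc,
      ev_apply_trd (con1 C x) hc,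
      ev_apply_fst (fun l j k => ∑ a, jac C x k a * con1 C x j l a) ha,
      ev_apply_trd (fun l j a => con1 C x j l a) hc, ev_swap_left (con1 C x)]
    ring
  have h1 := ev_alt3_eq_zero (contract_T1 hC hT1 x) u v w
  have h2 := ev_alt3_eq_zero (contract_T2 hC hT2 x) u v w
  rw [e1 hu, e1 hu, e1 hv, e1 hv, e1 hw, e1 hw] at h1
  rw [e2 hu hw, e2 hu hv, e2 hv hw, e2 hv hu, e2 hw hv, e2 hw hu] at h2
  have s1 := ev_con1_swap hC x u v w
  have s2 := ev_con1_swap hC x v w u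
  have s3 := ev_con1_swap hC x w u v
  rw [s1, s2, s3] at h1 h2
  rw [ev_Nij hC hu hv hw]
  have := eq_zero_of_system (α := α) (β := β) (γ := γ) (ev_con1_cyclic hC x u v w)
    (by linarith) (by linarith)
  linear_combination 16 * this

/-- A three-tensor vanishing on all triples of eigenvectors of the Jacobi form vanishes. -/
lemma eq_zero_of_forall_eigen (hC : IsACT C) (x : Fin m → ℝ) (T : Fin m → Fin m → Fin m → ℝ)
    (h : ∀ (u v w : Fin m → ℝ) (α β γ : ℝ), (∀ l, ∑ i, jac C x i l * u i = α * u l) →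
      (∀ l, ∑ i, jac C x i l * v i = β * v l) → (∀ l, ∑ i, jac C x i l * w i = γ * w l) →
      ev T u v w = 0) (i j k : Fin m) : T i j k = 0 := by
  let A : Matrix (Fin m) (Fin m) ℝ := Matrix.of (jac C x)
  have hA : A.IsHermitian := by
    ext i j
    exact jac_symm hC x j i
  let e (a : Fin m) : Fin m → ℝ := hA.eigenvectorBasis a
  have he (a l : Fin m) : ∑ i, jac C x i l * e a i = hA.eigenvalues a * e a l := by
    have := congrFun (hA.mulVec_eigenvectorBasis a) l
    simp only [fun i => jac_symm hC x i l]
    exact this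
  have hz (f : Fin m → ℝ) (hf : ∀ a, ∑ i, f i * e a i = 0) (i : Fin m) : f i = 0 := by
    have : WithLp.toLp 2 f = (0 : EuclideanSpace ℝ (Fin m)) := by
      refine hA.eigenvectorBasis.repr.injective ?_
      ext a
      rw [map_zero, OrthonormalBasis.repr_apply_apply, PiLp.inner_apply]
      exact hf a
    exact congrArg (fun g : EuclideanSpace ℝ (Fin m) => g i) this
  refine hz (fun k => T i j k) (fun c => ?_) k
  refine hz (fun j => ∑ k, T i j k * e c k) (fun b => ?_) j
  refine hz (fun i => ∑ j, (∑ k, T i j k * e c k) * e b j) (fun a => ?_) i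
  rw [← h (e a) (e b) (e c) _ _ _ (he a) (he b) (he c)]
  simp only [ev, Finset.sum_mul]
  refine Finset.sum_congr rfl fun i _ => Finset.sum_congr rfl fun j _ =>
    Finset.sum_congr rfl fun k _ => by ring

lemma haantjes_eq (hC : IsACT C) (x : Fin m → ℝ) (i j k : Fin m) :
    ∑ l, ∑ a,
        (Kf C x i a * Kf C x a l * Nij C x l j k
          + Nij C x i l a * Kf C x l j * Kf C x a k
          - Kf C x i l * Nij C x l j a * Kf C x a k
          - Kf C x i l * Nij C x l a k * Kf C x a j) =
      16 * (∑ a, jac C x i a * (∑ l, jac C x a l * Nij C x l j k)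
        + ∑ l, jac C x j l * (∑ a, jac C x k a * Nij C x i l a)
        - ∑ l, jac C x i l * (∑ a, jac C x k a * Nij C x l j a)
        - ∑ l, jac C x i l * (∑ a, jac C x j a * Nij C x l a k)) := by
  simp only [Finset.mul_sum]
  rw [Finset.sum_comm (f := fun a l => jac C x i a * (jac C x a l * Nij C x l j k))]
  simp only [← Finset.sum_add_distrib, ← Finset.sum_sub_distrib, Finset.mul_sum]
  refine Finset.sum_congr rfl fun l _ => Finset.sum_congr rfl fun a _ => ?_
  have hK (p q : Fin m) : Kf C x p q = 4 * jac C x p q := rfl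
  rw [jac_symm hC x j l, jac_symm hC x k a, jac_symm hC x j a]
  simp only [hK]
  ring

end eigenvectors

end HaantjesTSN

/-- If an algebraic curvature tensor on `ℝ^m` (`m ≥ 2`) satisfies the first and second
TSN conditions (T1) and (T2), then the Haantjes tensor of
`K^i_j(x) = 4 Σ_{k,l} C_{ikjl} xₖ xₗ` vanishes identically on `ℝ^m`. -/
theorem haantjes_vanishes_from_T1_T2 {m : ℕ} (hm : 2 ≤ m)
    (C : Fin m → Fin m → Fin m → Fin m → ℝ) (hC : IsACT C)
    (hT1 : T1 C) (hT2 : T2 C) :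
    ∀ (x : Fin m → ℝ) (i j k : Fin m),
      ∑ l, ∑ a,
        (Kf C x i a * Kf C x a l * Nij C x l j k
          + Nij C x i l a * Kf C x l j * Kf C x a k
          - Kf C x i l * Nij C x l j a * Kf C x a k
          - Kf C x i l * Nij C x l a k * Kf C x a j) = 0 := by
  intro x
  refine HaantjesTSN.eq_zero_of_forall_eigen hC x _ fun u v w α β γ hu hv hw => ?_
  simp only [HaantjesTSN.haantjes_eq hC]
  open HaantjesTSN in
  rw [ev_smul, ev_sub, ev_sub, ev_add,
    ev_apply_fst (fun a j k => ∑ l, jac C x a l * Nij C x l j k) hu,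
    ev_apply_fst (fun l j k => Nij C x l j k) hu,
    ev_apply_snd (fun i l k => ∑ a, jac C x k a * Nij C x i l a) hv,
    ev_apply_trd (fun i l a => Nij C x i l a) hw,
    ev_apply_fst (fun l j k => ∑ a, jac C x k a * Nij C x l j a) hu,
    ev_apply_trd (fun l j a => Nij C x l j a) hw,
    ev_apply_fst (fun l j k => ∑ a, jac C x j a * Nij C x l a k) hu,
    ev_apply_snd (fun l a k => Nij C x l a k) hv]
  linear_combination 16 * HaantjesTSN.haantjes_eigen hC hT1 hT2 hu hv hw
end
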